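/- arXiv:1705.05033 — 3 statements merged into one kernel-verified Lean document; each statement's English description precedes it below -/
import Mathlib

section
/- Let (I_{1,n})_{n≥0}, …, (I_{r,n})_{n≥0} and (J_{1,n})_{n≥0}, …, (J_{s,n})_{n≥0} be Noetherian graded families of monomial ideals of R. For n ≥ 1 set S_n = {a ∈ ℕ^d : x^a ∈ I_{i,n} for every 1 ≤ i ≤ r, and x^a ∉ J_{j,n} for every 1 ≤ j ≤ s}, and let f(n) = |S_n|. Assume f(n) < ∞ for all sufficiently large n. Then f eventually agrees with a quasi-polynomial of degree at most d: there exist N ∈ ℕ, an integer π ≥ 1, and polynomials p_0,…,p_{π−1} ∈ ℚ[T], each of degree at most d, such that f(n) = p_{n mod π}(n) for all n ≥ N. -/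
open MvPolynomial

/-- An ideal of `k[x_1, …, x_d]` is a monomial ideal if it is generated by monomials. -/
def IsMonomialIdeal {k : Type} [Field k] {d : ℕ} (I : Ideal (MvPolynomial (Fin d) k)) : Prop :=
  ∃ S : Set (Fin d →₀ ℕ),
    I = Ideal.span ((fun a => (monomial a (1 : k) : MvPolynomial (Fin d) k)) '' S)

/-- A Noetherian graded family of monomial ideals: `I_0 = R`, `I_m ⬝ I_n ⊆ I_{m+n}`,
each `I_n` is a monomial ideal, and `I_n = Σ_{j=1}^N I_j ⬝ I_{n-j}` for all `n > N`,
for some `N ≥ 1`. -/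
def IsNoethGradedMonomialFamily {k : Type} [Field k] {d : ℕ}
    (I : ℕ → Ideal (MvPolynomial (Fin d) k)) : Prop :=
  (∀ n, IsMonomialIdeal (I n)) ∧ I 0 = ⊤ ∧ (∀ m n, I m * I n ≤ I (m + n)) ∧
    ∃ N : ℕ, 1 ≤ N ∧ ∀ n, N < n → I n = ∑ j ∈ Finset.Icc 1 N, I j * I (n - j)

/-- The shift operator `f ↦ (n ↦ f (n + 1))` on rational sequences. -/
def seqShift : Module.End ℚ (ℕ → ℚ) where
  toFun f n := f (n + 1)
  map_add' _ _ := rfl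
  map_smul' _ _ := rfl

theorem seqShift_pow_apply (m : ℕ) (f : ℕ → ℚ) (n : ℕ) : (seqShift ^ m) f n = f (n + m) := by
  induction m generalizing n with
  | zero => rfl
  | succ m ih =>
    rw [pow_succ', Module.End.mul_apply]
    change (seqShift ^ m) f (n + 1) = _
    rw [ih, add_assoc, add_comm 1 m]

open scoped Polynomial in
/-- A rational sequence is eventually quasi-polynomial if it is annihilated by some operator
`E ^ N * (E ^ q - 1) ^ e` with `q ≥ 1`, where `E` is the shift. -/
def EventuallyQuasiPoly (f : ℕ → ℚ) : Prop :=
  ∃ q N e : ℕ, 1 ≤ q ∧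
    Polynomial.aeval seqShift (Polynomial.X ^ N * (Polynomial.X ^ q - 1) ^ e : ℚ[X]) f = 0

open scoped Polynomial in
theorem aeval_seqShift_eq_zero_of_dvd {p q : ℚ[X]} (h : p ∣ q) {f : ℕ → ℚ}
    (hp : Polynomial.aeval seqShift p f = 0) : Polynomial.aeval seqShift q f = 0 := by
  obtain ⟨r, rfl⟩ := h
  rw [mul_comm, map_mul, Module.End.mul_apply, hp, map_zero]

namespace EventuallyQuasiPoly

open scoped Polynomial

theorem sub {f g : ℕ → ℚ} (hf : EventuallyQuasiPoly f) (hg : EventuallyQuasiPoly g) :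
    EventuallyQuasiPoly (f - g) := by
  obtain ⟨q, N, e, hq, hf⟩ := hf
  obtain ⟨q', N', e', hq', hg⟩ := hg
  refine ⟨q * q', N + N', e + e', Nat.mul_pos hq hq', ?_⟩
  rw [map_sub, aeval_seqShift_eq_zero_of_dvd _ hf, aeval_seqShift_eq_zero_of_dvd _ hg, sub_zero]
  · refine mul_dvd_mul (pow_dvd_pow _ (by omega)) ((pow_dvd_pow_of_dvd ?_ e').trans
      (pow_dvd_pow _ (by omega)))
    rw [mul_comm, pow_mul]
    simpa using sub_dvd_pow_sub_pow (Polynomial.X ^ q' : ℚ[X]) 1 q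
  · refine mul_dvd_mul (pow_dvd_pow _ (by omega)) ((pow_dvd_pow_of_dvd ?_ e).trans
      (pow_dvd_pow _ (by omega)))
    rw [pow_mul]
    simpa using sub_dvd_pow_sub_pow (Polynomial.X ^ q : ℚ[X]) 1 q'

theorem zero : EventuallyQuasiPoly 0 := ⟨1, 0, 0, le_rfl, by simp⟩

theorem add {f g : ℕ → ℚ} (hf : EventuallyQuasiPoly f) (hg : EventuallyQuasiPoly g) :
    EventuallyQuasiPoly (f + g) := by
  simpa using hf.sub (zero.sub hg)

theorem of_shift {f g : ℕ → ℚ} (c : ℕ) (hg : EventuallyQuasiPoly g)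
    (h : ∀ n, f (n + c) = g n) : EventuallyQuasiPoly f := by
  obtain ⟨q, N, e, hq, hg⟩ := hg
  refine ⟨q, N + c, e, hq, ?_⟩
  have : g = Polynomial.aeval seqShift (Polynomial.X ^ c : ℚ[X]) f := by
    ext n
    simp [seqShift_pow_apply, h]
  rw [this, ← Module.End.mul_apply, ← map_mul] at hg
  rw [← hg]
  congr 2
  ring

theorem shift {f : ℕ → ℚ} (c : ℕ) (hf : EventuallyQuasiPoly f) :
    EventuallyQuasiPoly fun n => f (n + c) := by
  obtain ⟨q, N, e, hq, hf⟩ := hf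
  refine ⟨q, N, e, hq, ?_⟩
  have : (fun n => f (n + c)) = Polynomial.aeval seqShift (Polynomial.X ^ c : ℚ[X]) f := by
    ext n
    simp [seqShift_pow_apply]
  rw [this, ← Module.End.mul_apply, ← map_mul]
  exact aeval_seqShift_eq_zero_of_dvd (Dvd.intro _ rfl) hf

theorem of_sub_shift {f : ℕ → ℚ} {w : ℕ} (hw : 1 ≤ w)
    (hg : EventuallyQuasiPoly fun n => f (n + w) - f n) : EventuallyQuasiPoly f := by
  obtain ⟨q, N, e, hq, hg⟩ := hg
  refine ⟨q * w, N, e + 1, Nat.mul_pos hq hw, ?_⟩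
  have : (fun n => f (n + w) - f n) =
      Polynomial.aeval seqShift (Polynomial.X ^ w - 1 : ℚ[X]) f := by
    ext n
    simp [seqShift_pow_apply]
  rw [this, ← Module.End.mul_apply, ← map_mul] at hg
  refine aeval_seqShift_eq_zero_of_dvd ?_ hg
  rw [pow_succ, ← mul_assoc]
  refine mul_dvd_mul (mul_dvd_mul_left _ (pow_dvd_pow_of_dvd ?_ e)) ?_
  · rw [pow_mul]
    simpa using sub_dvd_pow_sub_pow (Polynomial.X ^ q : ℚ[X]) 1 w
  · rw [mul_comm, pow_mul]
    simpa using sub_dvd_pow_sub_pow (Polynomial.X ^ w : ℚ[X]) 1 q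

theorem of_eventually_zero {f : ℕ → ℚ} (c : ℕ) (h : ∀ n, f (n + c) = 0) :
    EventuallyQuasiPoly f :=
  zero.of_shift c h

theorem exists_polynomial {f : ℕ → ℚ} (hf : EventuallyQuasiPoly f) :
    ∃ N q : ℕ, 1 ≤ q ∧ ∃ p : ℕ → ℚ[X], ∀ n, N ≤ n → f n = (p (n % q)).eval (n : ℚ) := by
  obtain ⟨q, N, e, hq, hf⟩ := hf
  have hdiff : ∀ k (g : ℕ → ℚ), (fwdDiff q)^[k] g = ((seqShift ^ q - 1) ^ k) g := by
    intro k
    induction k with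
    | zero => intro g; rfl
    | succ k ih =>
      intro g
      rw [Function.iterate_succ_apply, ih, pow_succ, Module.End.mul_apply]
      congr 1
      ext n
      simp [fwdDiff, seqShift_pow_apply]
  have hzero : ∀ n, N ≤ n → ∀ k, e ≤ k → (fwdDiff q)^[k] f n = 0 := by
    intro n hn k hk
    have h := aeval_seqShift_eq_zero_of_dvd
      (mul_dvd_mul_left (Polynomial.X ^ N) (pow_dvd_pow (Polynomial.X ^ q - 1 : ℚ[X]) hk)) hf
    rw [map_mul, Module.End.mul_apply] at h
    have := congrFun h (n - N)
    simp only [map_pow, Polynomial.aeval_X, map_sub, map_one, seqShift_pow_apply, Pi.zero_apply,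
      Nat.sub_add_cancel hn] at this
    rw [hdiff, this]
  let c : ℕ → ℚ[X] := fun j => ∑ k ∈ Finset.range e,
    Polynomial.C ((fwdDiff q)^[k] f (j + q * N) / k.factorial) * descPochhammer ℚ k
  have hc : ∀ j m : ℕ, f (j + q * N + m * q) = (c j).eval (m : ℚ) := by
    intro j m
    have hjN : N ≤ j + q * N := (Nat.le_mul_of_pos_left N hq).trans (Nat.le_add_left _ _)
    have h := shift_eq_sum_fwdDiff_iter q f m (j + q * N)
    rw [smul_eq_mul] at h
    rw [h, Polynomial.eval_finsetSum]
    have hterm : ∀ k, (Polynomial.C ((fwdDiff q)^[k] f (j + q * N) / k.factorial) *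
        descPochhammer ℚ k).eval (m : ℚ) = m.choose k • (fwdDiff q)^[k] f (j + q * N) := by
      intro k
      rw [Polynomial.eval_mul, Polynomial.eval_C, descPochhammer_eval_eq_descFactorial,
        Nat.descFactorial_eq_factorial_mul_choose, nsmul_eq_mul]
      have : (k.factorial : ℚ) ≠ 0 := by exact_mod_cast k.factorial_ne_zero
      push_cast
      field_simp
    simp_rw [hterm]
    rw [Finset.sum_subset (Finset.range_subset_range.2 (le_max_left (m + 1) e)),
      Finset.sum_subset (Finset.range_subset_range.2 (le_max_right (m + 1) e))]
    · intro k _ hk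
      rw [hzero _ hjN k (by simpa using hk), smul_zero]
    · intro k _ hk
      rw [Nat.choose_eq_zero_of_lt (by simpa using hk), zero_smul]
  refine ⟨q * N, q, hq, fun j =>
    (c j).comp (Polynomial.C (1 / q : ℚ) * (Polynomial.X - Polynomial.C (j + q * N : ℚ))), ?_⟩
  intro n hn
  have hN : N ≤ n / q := (Nat.le_div_iff_mul_le hq).2 (by rwa [mul_comm])
  obtain ⟨m, hm⟩ := Nat.exists_eq_add_of_le hN
  have hn' : n = n % q + q * N + m * q := by
    conv_lhs => rw [← Nat.mod_add_div n q, hm]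
    ring
  have hq0 : (q : ℚ) ≠ 0 := by positivity
  have hev : (1 / q : ℚ) * (n - ((n % q : ℕ) + q * N)) = m := by
    have : (n : ℚ) = (n % q : ℕ) + q * N + m * q := by exact_mod_cast hn'
    rw [this]
    field_simp
    ring
  rw [Polynomial.eval_comp, Polynomial.eval_mul, Polynomial.eval_C, Polynomial.eval_sub,
    Polynomial.eval_X, Polynomial.eval_C, hev, ← hc, ← hn']

end EventuallyQuasiPoly

open scoped Polynomial in
theorem natDegree_le_of_abs_eval_le_on_progression {p : ℚ[X]} {d j q N : ℕ} {c : ℚ} (hq : 1 ≤ q)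
    (h : ∀ n : ℕ, N ≤ n → n % q = j → |p.eval (n : ℚ)| ≤ c * (n : ℚ) ^ d) (hj : j < q) :
    p.natDegree ≤ d := by
  by_contra! hlt
  have hdeg : (Polynomial.X ^ d : ℚ[X]).degree < p.degree :=
    Polynomial.degree_lt_degree (by simpa using hlt)
  have ht := p.abs_div_tendsto_atTop_atTop_of_degree_gt (Polynomial.X ^ d) hdeg (by simp)
  have hseq : Filter.Tendsto (fun m : ℕ => ((j + q * m : ℕ) : ℚ)) Filter.atTop Filter.atTop := by
    refine tendsto_natCast_atTop_atTop.comp (Filter.tendsto_atTop_mono (fun m => ?_)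
      Filter.tendsto_id)
    exact (Nat.le_mul_of_pos_left m hq).trans (Nat.le_add_left _ _)
  obtain ⟨m, hm, hm'⟩ := ((ht.comp hseq).eventually_gt_atTop c |>.and
    (Filter.eventually_ge_atTop (N + 1))).exists
  have hle : N + 1 ≤ j + q * m :=
    hm'.trans ((Nat.le_mul_of_pos_left m hq).trans (Nat.le_add_left _ _))
  have h1 := h (j + q * m) (by omega) (by simp [Nat.add_mul_mod_self_left, Nat.mod_eq_of_lt hj])
  have hpos : (0 : ℚ) < ((j + q * m : ℕ) : ℚ) ^ d := by
    have : 0 < j + q * m := by omega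
    positivity
  simp only [Function.comp_apply, Polynomial.eval_pow, Polynomial.eval_X, abs_div,
    abs_of_pos hpos] at hm
  rw [lt_div_iff₀ hpos] at hm
  exact absurd h1 (not_le.2 hm)

/-- `s` has finite fibres over `ℕ` under the height `h`, and the number of points of `s` of
height `n` is eventually quasi-polynomial in `n`. -/
def HasQuasiPolyCount {X : Type*} (h : X → ℕ) (s : Set X) : Prop :=
  (∀ n, (s ∩ h ⁻¹' {n}).Finite) ∧
    EventuallyQuasiPoly fun n => ((s ∩ h ⁻¹' {n}).ncard : ℚ)

namespace HasQuasiPolyCount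

variable {X Y : Type*} {h : X → ℕ} {s t : Set X}

theorem empty : HasQuasiPolyCount h ∅ := by
  refine ⟨by simp, ?_⟩
  simp only [Set.empty_inter, Set.ncard_empty, Nat.cast_zero]
  exact EventuallyQuasiPoly.zero

theorem union (hs : HasQuasiPolyCount h s) (ht : HasQuasiPolyCount h t)
    (hst : HasQuasiPolyCount h (s ∩ t)) : HasQuasiPolyCount h (s ∪ t) := by
  refine ⟨fun n => ?_, ?_⟩
  · rw [Set.union_inter_distrib_right]
    exact (hs.1 n).union (ht.1 n)
  · convert (hs.2.add ht.2).sub hst.2 using 1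
    ext n
    have := Set.ncard_union_add_ncard_inter (s ∩ h ⁻¹' {n}) (t ∩ h ⁻¹' {n}) (hs.1 n) (ht.1 n)
    rw [← Set.union_inter_distrib_right, ← Set.inter_inter_distrib_right] at this
    simp only [Pi.sub_apply, Pi.add_apply]
    rw [eq_sub_iff_add_eq]
    exact_mod_cast this

theorem sdiff (hts : t ⊆ s) (hs : HasQuasiPolyCount h s) (ht : HasQuasiPolyCount h t) :
    HasQuasiPolyCount h (s \ t) := by
  refine ⟨fun n => (hs.1 n).subset (Set.inter_subset_inter_left _ Set.sdiff_subset), ?_⟩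
  convert hs.2.sub ht.2 using 1
  ext n
  have := Set.ncard_sdiff_add_ncard_of_subset
    (Set.inter_subset_inter_left (h ⁻¹' {n}) hts) (hs.1 n)
  rw [← Set.inter_sdiff_distrib_right] at this
  simp only [Pi.sub_apply]
  rw [eq_sub_iff_add_eq]
  exact_mod_cast this

theorem image {h' : Y → ℕ} {f : X → Y} (c : ℕ) (hf : Set.InjOn f s)
    (hh : ∀ x ∈ s, h' (f x) = h x + c) (hs : HasQuasiPolyCount h s) :
    HasQuasiPolyCount h' (f '' s) := by
  refine ⟨fun n => ((hs.1 (n - c)).image f).subset ?_, hs.2.of_shift c fun n => ?_⟩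
  · rintro _ ⟨⟨x, hx, rfl⟩, hn⟩
    refine ⟨x, ⟨hx, ?_⟩, rfl⟩
    have := hh x hx
    simp only [Set.mem_preimage, Set.mem_singleton_iff] at hn ⊢
    omega
  · have : f '' s ∩ h' ⁻¹' {n + c} = f '' (s ∩ h ⁻¹' {n}) := by
      ext y
      constructor
      · rintro ⟨⟨x, hx, rfl⟩, hn⟩
        refine ⟨x, ⟨hx, ?_⟩, rfl⟩
        have := hh x hx
        simp only [Set.mem_preimage, Set.mem_singleton_iff] at hn ⊢
        omega
      · rintro ⟨x, ⟨hx, hn⟩, rfl⟩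
        refine ⟨⟨x, hx, rfl⟩, ?_⟩
        have := hh x hx
        simp only [Set.mem_preimage, Set.mem_singleton_iff] at hn ⊢
        omega
    rw [this, (hf.mono Set.inter_subset_left).ncard_image]

/-- Inclusion-exclusion: finite unions of members of an intersection-closed class. -/
theorem sUnion {𝒞 : Set (Set X)} (hinter : ∀ s ∈ 𝒞, ∀ t ∈ 𝒞, s ∩ t ∈ 𝒞)
    (hcount : ∀ s ∈ 𝒞, HasQuasiPolyCount h s) {𝒮 : Set (Set X)} (hfin : 𝒮.Finite)
    (hsub : 𝒮 ⊆ 𝒞) : HasQuasiPolyCount h (⋃₀ 𝒮) := by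
  suffices H : HasQuasiPolyCount h (⋃₀ 𝒮) ∧ ∀ s ∈ 𝒞, HasQuasiPolyCount h (s ∩ ⋃₀ 𝒮) from H.1
  induction 𝒮, hfin using Set.Finite.induction_on with
  | empty => simp [empty]
  | @insert t 𝒮 _ _ ih =>
    obtain ⟨ih₁, ih₂⟩ := ih ((Set.subset_insert _ _).trans hsub)
    have ht : t ∈ 𝒞 := hsub (Set.mem_insert _ _)
    rw [Set.sUnion_insert]
    refine ⟨(hcount t ht).union ih₁ (ih₂ t ht), fun s hs => ?_⟩
    rw [Set.inter_union_distrib_left]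
    refine (hcount _ (hinter s hs t ht)).union (ih₂ s hs) ?_
    rw [← Set.inter_inter_distrib_left, ← Set.inter_assoc]
    exact ih₂ _ (hinter s hs t ht)

end HasQuasiPolyCount

theorem finite_dotProduct_eq {m : ℕ} {w : Fin m → ℕ} (hw : ∀ i, 1 ≤ w i) (n : ℕ) :
    {u : Fin m → ℕ | w ⬝ᵥ u = n}.Finite := by
  refine (Set.finite_Iic (fun _ => n : Fin m → ℕ)).subset ?_
  rintro u rfl i
  exact (Nat.le_mul_of_pos_left _ (hw i)).trans
    (Finset.single_le_sum (f := fun i => w i * u i) (fun _ _ => Nat.zero_le _) (Finset.mem_univ i))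

theorem hasQuasiPolyCount_dotProduct_univ {m : ℕ} {w : Fin m → ℕ} (hw : ∀ i, 1 ≤ w i) :
    HasQuasiPolyCount (fun u => w ⬝ᵥ u) Set.univ := by
  induction m with
  | zero =>
    refine ⟨fun n => Set.toFinite _, EventuallyQuasiPoly.of_eventually_zero 1 fun n => ?_⟩
    have : (Set.univ ∩ (fun u => w ⬝ᵥ u) ⁻¹' {n + 1} : Set (Fin 0 → ℕ)) = ∅ := by
      ext u
      simp
    rw [this, Set.ncard_empty, Nat.cast_zero]
  | succ m ih =>
    have hfin : ∀ n, ((fun u => w ⬝ᵥ u) ⁻¹' {n}).Finite := finite_dotProduct_eq hw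
    have hfin' : ∀ n, ((fun u => Fin.tail w ⬝ᵥ u) ⁻¹' {n}).Finite :=
      finite_dotProduct_eq fun i => hw i.succ
    have ih := (ih (w := Fin.tail w) fun i => hw i.succ).2
    simp only [Set.univ_inter] at ih
    refine ⟨fun n => by simpa using hfin n, EventuallyQuasiPoly.of_sub_shift (hw 0) ?_⟩
    convert ih.shift (w 0) using 1
    ext n
    simp only [Set.univ_inter]
    have hsplit : (fun u => w ⬝ᵥ u) ⁻¹' {n + w 0} =
        (fun u : Fin (m + 1) → ℕ => u + Pi.single 0 1) '' ((fun u => w ⬝ᵥ u) ⁻¹' {n}) ∪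
          Fin.cons (α := fun _ => ℕ) 0 ''
            ((fun u => Fin.tail w ⬝ᵥ u) ⁻¹' {n + w 0}) := by
      ext u
      constructor
      · intro hu
        by_cases hu0 : u 0 = 0
        · refine Or.inr ⟨Fin.tail u, ?_, ?_⟩
          · simpa [dotProduct, Fin.sum_univ_succ, hu0, Fin.tail] using hu
          · rw [← hu0]
            exact Fin.cons_self_tail u
        · have hle : (Pi.single 0 1 : Fin (m + 1) → ℕ) ≤ u := by
            intro i
            refine Fin.cases ?_ (fun i => ?_) i
            · simpa using Nat.one_le_iff_ne_zero.2 hu0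
            · simp
          refine Or.inl ⟨u - Pi.single 0 1, ?_, tsub_add_cancel_of_le hle⟩
          have h1 : w ⬝ᵥ (u - Pi.single 0 1 + Pi.single 0 1) = n + w 0 := by
            rw [tsub_add_cancel_of_le hle]
            exact hu
          rw [dotProduct_add] at h1
          simpa using h1
      · rintro (⟨v, hv, rfl⟩ | ⟨v, hv, rfl⟩)
        · simpa [dotProduct_add] using hv
        · simpa [dotProduct, Fin.sum_univ_succ, Fin.tail] using hv
    rw [hsplit, Set.ncard_union_eq ?_ ((hfin n).image _)
        ((hfin' _).image _), Set.ncard_image_of_injective _ (add_left_injective _),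
      Set.ncard_image_of_injective _ (Fin.cons_right_injective _)]
    · push_cast
      ring
    · rw [Set.disjoint_left]
      rintro _ ⟨u, -, rfl⟩ ⟨v, -, hv⟩
      simpa using congrFun hv 0

theorem IsUpperSet.exists_finite_eq_biUnion_Ici {α : Type*} [PartialOrder α]
    [WellQuasiOrderedLE α] {U : Set α} (hU : IsUpperSet U) :
    ∃ B : Set α, B.Finite ∧ B ⊆ U ∧ U = ⋃ b ∈ B, Set.Ici b := by
  have hpwo := Set.isPWO_of_wellQuasiOrderedLE U
  refine ⟨_, (setOfPred_minimal_antichain (· ∈ U)).finite_of_partiallyWellOrderedOn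
    (Set.isPWO_of_wellQuasiOrderedLE _), fun x hx => hx.prop, ?_⟩
  ext x
  simp only [Set.mem_iUnion, Set.mem_Ici, exists_prop]
  constructor
  · intro hx
    obtain ⟨b, hb, hmin⟩ := hpwo.exists_le_minimal hx
    exact ⟨b, hmin, hb⟩
  · rintro ⟨b, hb, hle⟩
    exact hU hle hb.prop

theorem hasQuasiPolyCount_compl_of_isUpperSet {m : ℕ} {w : Fin m → ℕ} (hw : ∀ i, 1 ≤ w i)
    {U : Set (Fin m → ℕ)} (hU : IsUpperSet U) : HasQuasiPolyCount (fun u => w ⬝ᵥ u) Uᶜ := by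
  rw [Set.compl_eq_univ_sdiff]
  refine (hasQuasiPolyCount_dotProduct_univ hw).sdiff (Set.subset_univ _) ?_
  obtain ⟨B, hB, -, rfl⟩ := hU.exists_finite_eq_biUnion_Ici
  rw [← Set.sUnion_image]
  refine HasQuasiPolyCount.sUnion (𝒞 := Set.range Set.Ici) ?_ ?_ (hB.image _)
    (Set.image_subset_range _ _)
  · rintro _ ⟨a, rfl⟩ _ ⟨b, rfl⟩
    exact ⟨a ⊔ b, Set.Ici_inter_Ici.symm⟩
  · rintro _ ⟨a, rfl⟩
    have : Set.Ici a = (fun u => u + a) '' Set.univ := by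
      ext u
      simp only [Set.mem_Ici, Set.image_univ, Set.mem_range]
      exact ⟨fun h => ⟨u - a, tsub_add_cancel_of_le h⟩, fun ⟨v, hv⟩ => hv ▸ le_add_self⟩
    rw [this]
    exact (hasQuasiPolyCount_dotProduct_univ hw).image (w ⬝ᵥ a) (add_left_injective a).injOn
      fun x _ => dotProduct_add _ _ _

section Hybrid

open scoped Pointwise

variable {M : Type*} [AddCommMonoid M]

/-- A hybrid linear set: the sum of a finite set and a finitely generated submonoid. -/
def IsHybridLinearSet (s : Set M) : Prop :=
  ∃ (B : Set M) (P : AddSubmonoid M), B.Finite ∧ P.FG ∧ s = B + (P : Set M)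

theorem IsLinearSet.isHybridLinearSet {s : Set M} (hs : IsLinearSet s) : IsHybridLinearSet s := by
  obtain ⟨a, P, hP, rfl⟩ := isLinearSet_iff_exists_fg_eq_vadd.1 hs
  exact ⟨{a}, P, Set.finite_singleton a, hP, by rw [Set.singleton_add]; rfl⟩

theorem IsHybridLinearSet.inter [IsCancelAdd M] {s t : Set M} (hs : IsHybridLinearSet s)
    (ht : IsHybridLinearSet t) : IsHybridLinearSet (s ∩ t) := by
  obtain ⟨B₁, P₁, hB₁, hP₁, rfl⟩ := hs
  obtain ⟨B₂, P₂, hB₂, hP₂, rfl⟩ := ht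
  obtain ⟨m₁, φ₁, rfl⟩ := AddSubmonoid.fg_iff_exists_fin_addMonoidHom.1 hP₁
  obtain ⟨m₂, φ₂, rfl⟩ := AddSubmonoid.fg_iff_exists_fin_addMonoidHom.1 hP₂
  let ψ₁ : (Fin m₁ → ℕ) × (Fin m₂ → ℕ) →+ M := φ₁.comp (AddMonoidHom.fst _ _)
  let ψ₂ : (Fin m₁ → ℕ) × (Fin m₂ → ℕ) →+ M := φ₂.comp (AddMonoidHom.snd _ _)
  let T : M → M → Set ((Fin m₁ → ℕ) × (Fin m₂ → ℕ)) := fun b₁ b₂ => {z | b₁ + ψ₁ z = b₂ + ψ₂ z}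
  have hT : ∀ b₁ b₂, {z | Minimal (· ∈ T b₁ b₂) z}.Finite := fun b₁ b₂ =>
    (setOfPred_minimal_antichain _).finite_of_partiallyWellOrderedOn
      (Set.isPWO_of_wellQuasiOrderedLE _)
  refine ⟨⋃ b₁ ∈ B₁, ⋃ b₂ ∈ B₂, (fun z => b₁ + ψ₁ z) '' {z | Minimal (· ∈ T b₁ b₂) z},
    (ψ₁.eqLocusM ψ₂).map ψ₁, hB₁.biUnion fun b₁ _ => hB₂.biUnion fun b₂ _ => (hT b₁ b₂).image _,
    (AddSubmonoid.fg_eqLocusM ψ₁ ψ₂).map _, ?_⟩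
  ext x
  simp only [Set.mem_inter_iff, Set.mem_add, Set.mem_iUnion, Set.mem_image, SetLike.mem_coe,
    AddMonoidHom.mem_mrange, AddSubmonoid.mem_map, exists_prop]
  constructor
  · rintro ⟨⟨b₁, hb₁, _, ⟨u, rfl⟩, rfl⟩, b₂, hb₂, _, ⟨v, rfl⟩, hv⟩
    have hz : (u, v) ∈ T b₁ b₂ := hv.symm
    obtain ⟨z, hz, hmin⟩ := (Set.isPWO_of_wellQuasiOrderedLE (T b₁ b₂)).exists_le_minimal hz
    obtain ⟨e, he⟩ := exists_add_of_le hz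
    have h₁ : φ₁ u = ψ₁ z + ψ₁ e := by
      rw [← map_add, ← he]
      rfl
    have h₂ : φ₂ v = ψ₂ z + ψ₂ e := by
      rw [← map_add, ← he]
      rfl
    refine ⟨_, ⟨b₁, hb₁, b₂, hb₂, z, hmin, rfl⟩, _, ⟨e, ?_, rfl⟩, by rw [h₁, add_assoc]⟩
    have hz' : b₁ + ψ₁ z = b₂ + ψ₂ z := hmin.prop
    rw [h₁, h₂, ← add_assoc, ← add_assoc, ← hz'] at hv
    exact (add_left_cancel hv).symm
  · rintro ⟨_, ⟨b₁, hb₁, b₂, hb₂, z, hmin, rfl⟩, _, ⟨e, he, rfl⟩, rfl⟩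
    have hz' : b₁ + ψ₁ z = b₂ + ψ₂ z := hmin.prop
    have he : ψ₁ e = ψ₂ e := he
    refine ⟨⟨b₁, hb₁, _, ⟨(z + e).1, rfl⟩, ?_⟩, b₂, hb₂, _, ⟨(z + e).2, rfl⟩, ?_⟩
    · change b₁ + ψ₁ (z + e) = _
      rw [map_add, add_assoc]
    · change b₂ + ψ₂ (z + e) = _
      rw [map_add, hz', he, add_assoc]

theorem nsmul_left_injective_of_ne_zero [IsCancelAdd M] [IsAddTorsionFree M] {x : M}
    (hx : x ≠ 0) : Function.Injective fun k : ℕ => k • x := by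
  refine Function.Injective.of_lt_imp_ne fun j k hjk (h : j • x = k • x) => hx ?_
  obtain ⟨n, rfl⟩ := Nat.exists_eq_add_of_lt hjk
  rw [add_assoc, add_nsmul, left_eq_add] at h
  exact nsmul_right_injective n.succ_ne_zero (h.trans (nsmul_zero _).symm)

theorem AddSubmonoid.FG.exists_pos_addMonoidHom [IsCancelAdd M] [IsAddTorsionFree M]
    {P : AddSubmonoid M} (hP : P.FG) (h : M →+ ℕ) (b : M)
    (hfin : ((b +ᵥ (P : Set M)) ∩ h ⁻¹' {h b}).Finite) :
    ∃ (m : ℕ) (φ : (Fin m → ℕ) →+ M), AddMonoidHom.mrange φ = P ∧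
      ∀ i, 1 ≤ h (φ (Pi.single i 1)) := by
  classical
  obtain ⟨t, rfl⟩ := hP
  let e : Fin (t.erase 0).card → M := fun i => ((t.erase 0).equivFin.symm i : M)
  have hrange : Set.range e = (t : Set M) \ {0} := by
    rw [show e = Subtype.val ∘ (t.erase 0).equivFin.symm from rfl, Set.range_comp,
      Equiv.range_eq_univ, Set.image_univ, Subtype.range_coe_subtype]
    ext x
    simp [and_comm]
  let φ : (Fin (t.erase 0).card → ℕ) →+ M := (Fintype.linearCombination ℕ e).toAddMonoidHom
  have hφ : ∀ i, φ (Pi.single i 1) = e i := fun i => by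
    simp [φ, Fintype.linearCombination_apply_single]
  refine ⟨_, φ, ?_, fun i => ?_⟩
  · rw [← AddSubmonoid.closure_insert_zero (t : Set M), ← Set.insert_sdiff_singleton,
      AddSubmonoid.closure_insert_zero, ← hrange]
    ext x
    rw [AddSubmonoid.mem_closure_range_iff_of_fintype, AddMonoidHom.mem_mrange]
    simp only [φ, LinearMap.toAddMonoidHom_coe, Fintype.linearCombination_apply, eq_comm]
  · rw [hφ]
    by_contra! hlt
    have h0 : h (e i) = 0 := by omega
    have hmem : e i ∈ (t : Set M) \ {0} := hrange ▸ Set.mem_range_self i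
    have hinj : Function.Injective fun k : ℕ => b + k • e i :=
      (add_right_injective b).comp (nsmul_left_injective_of_ne_zero hmem.2)
    refine (Set.infinite_range_of_injective hinj) (hfin.subset ?_)
    rintro _ ⟨k, rfl⟩
    refine ⟨Set.vadd_mem_vadd_set (nsmul_mem (AddSubmonoid.subset_closure hmem.1) k), ?_⟩
    simp [h0]

theorem addMonoidHom_apply_eq_dotProduct {m : ℕ} (g : (Fin m → ℕ) →+ ℕ) (u : Fin m → ℕ) :
    g u = (fun i => g (Pi.single i 1)) ⬝ᵥ u := by
  have hu : u = ∑ i, u i • Pi.single i 1 := by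
    ext j
    simp [Finset.sum_apply, Pi.single_apply]
  conv_lhs => rw [hu, map_sum]
  simp only [map_nsmul, smul_eq_mul, dotProduct, mul_comm]

theorem hasQuasiPolyCount_vadd_mrange_sdiff [IsCancelAdd M] {m : ℕ} (φ : (Fin m → ℕ) →+ M)
    (h : M →+ ℕ) (hφ : ∀ i, 1 ≤ h (φ (Pi.single i 1))) (b : M) {T : Set M}
    (hT : ∀ x ∈ T, ∀ u, x + φ u ∈ T) :
    HasQuasiPolyCount h ((b +ᵥ (AddMonoidHom.mrange φ : Set M)) \ T) := by
  let U : Set (Fin m → ℕ) := {u | b + φ u ∈ T ∨ ∃ v, toLex v < toLex u ∧ φ v = φ u}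
  have hU : IsUpperSet U := by
    intro u u' hle hu
    obtain ⟨c, rfl⟩ := exists_add_of_le hle
    rcases hu with hu | ⟨v, hlt, hv⟩
    · left
      rw [map_add, ← add_assoc]
      exact hT _ hu c
    · refine Or.inr ⟨v + c, ?_, by rw [map_add, map_add, hv]⟩
      rw [toLex_add, toLex_add]
      exact add_lt_add_left hlt _
  have himage : (b +ᵥ (AddMonoidHom.mrange φ : Set M)) \ T = (fun u => b + φ u) '' Uᶜ := by
    ext x
    constructor
    · rintro ⟨⟨_, ⟨u, rfl⟩, rfl⟩, hx⟩
      obtain ⟨v, hv, hmin⟩ := (wellFounded_lt (α := Lex (Fin m → ℕ))).has_min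
        {v | φ (ofLex v) = φ u} ⟨toLex u, rfl⟩
      have hv : φ (ofLex v) = φ u := hv
      refine ⟨ofLex v, ?_, by simp only [hv]; rfl⟩
      rintro (hvT | ⟨v', hlt, hv'⟩)
      · rw [hv] at hvT
        exact hx hvT
      · exact hmin (toLex v') (hv'.trans hv) hlt
    · rintro ⟨u, hu, rfl⟩
      exact ⟨⟨φ u, ⟨u, rfl⟩, rfl⟩, fun hT => hu (Or.inl hT)⟩
  rw [himage]
  refine (hasQuasiPolyCount_compl_of_isUpperSet hφ hU).image (h b) ?_ fun u _ => ?_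
  · intro u hu v hv huv
    have huv : φ u = φ v := add_left_cancel huv
    rcases lt_trichotomy (toLex u) (toLex v) with hlt | heq | hlt
    · exact (hv (Or.inr ⟨u, hlt, huv⟩)).elim
    · exact toLex.injective heq
    · exact (hu (Or.inr ⟨v, hlt, huv.symm⟩)).elim
  · rw [map_add, add_comm]
    exact congrArg (· + h b) (addMonoidHom_apply_eq_dotProduct (h.comp φ) u)

theorem IsHybridLinearSet.hasQuasiPolyCount [IsCancelAdd M] [IsAddTorsionFree M] {s : Set M}
    (hs : IsHybridLinearSet s) (h : M →+ ℕ) (hfin : ∀ n, (s ∩ h ⁻¹' {n}).Finite) :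
    HasQuasiPolyCount h s := by
  obtain ⟨B, P, hB, hP, rfl⟩ := hs
  induction B, hB using Set.Finite.induction_on with
  | empty => simpa using HasQuasiPolyCount.empty
  | @insert b B _ _ ih =>
    rw [Set.insert_eq, Set.union_add, Set.singleton_add] at hfin ⊢
    change ∀ n, (((b +ᵥ (P : Set M)) ∪ _) ∩ _).Finite at hfin
    change HasQuasiPolyCount h ((b +ᵥ (P : Set M)) ∪ _)
    obtain ⟨m, φ, rfl, hφ⟩ := hP.exists_pos_addMonoidHom h b
      ((hfin _).subset (Set.inter_subset_inter_left _ Set.subset_union_left))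
    rw [← Set.sdiff_union_self]
    refine (hasQuasiPolyCount_vadd_mrange_sdiff φ h hφ b ?_).union
      (ih fun n => (hfin n).subset (Set.inter_subset_inter_left _ Set.subset_union_right)) ?_
    · rintro _ ⟨a, ha, _, ⟨v, rfl⟩, rfl⟩ u
      exact ⟨a, ha, φ (v + u), ⟨_, rfl⟩, by simp only [map_add, add_assoc]⟩
    · rw [Set.sdiff_inter_self]
      exact HasQuasiPolyCount.empty

theorem IsSemilinearSet.hasQuasiPolyCount [IsCancelAdd M] [IsAddTorsionFree M] {s : Set M}
    (hs : IsSemilinearSet s) (h : M →+ ℕ) (hfin : ∀ n, (s ∩ h ⁻¹' {n}).Finite) :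
    HasQuasiPolyCount h s := by
  obtain ⟨𝒮, h𝒮, hlin, rfl⟩ := hs
  refine HasQuasiPolyCount.sUnion
    (𝒞 := {s | IsHybridLinearSet s ∧ ∀ n, (s ∩ h ⁻¹' {n}).Finite}) ?_ ?_ h𝒮 ?_
  · exact fun s hs t ht => ⟨hs.1.inter ht.1, fun n => (hs.2 n).subset
      (Set.inter_subset_inter_left _ Set.inter_subset_left)⟩
  · exact fun s hs => hs.1.hasQuasiPolyCount h hs.2
  · exact fun s hs => ⟨(hlin s hs).isHybridLinearSet, fun n => (hfin n).subset
      (Set.inter_subset_inter_left _ (Set.subset_sUnion_of_mem hs))⟩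

theorem IsLinearSet.exists_le_mul_height [IsCancelAdd M] [IsAddTorsionFree M] {s : Set M}
    (hs : IsLinearSet s) (h g : M →+ ℕ) (hfin : ∀ n, (s ∩ h ⁻¹' {n}).Finite) :
    ∃ c, ∀ x ∈ s, g x ≤ c * (h x + 1) := by
  obtain ⟨b, P, hP, rfl⟩ := isLinearSet_iff_exists_fg_eq_vadd.1 hs
  obtain ⟨m, φ, rfl, hφ⟩ := hP.exists_pos_addMonoidHom h b (hfin _)
  refine ⟨g b + ∑ i, g (φ (Pi.single i 1)), ?_⟩
  rintro _ ⟨_, ⟨u, rfl⟩, rfl⟩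
  have hle : g (φ u) ≤ (∑ i, g (φ (Pi.single i 1))) * h (φ u) := by
    have h₁ := addMonoidHom_apply_eq_dotProduct (g.comp φ) u
    have h₂ := addMonoidHom_apply_eq_dotProduct (h.comp φ) u
    simp only [AddMonoidHom.comp_apply] at h₁ h₂
    rw [h₁, h₂, dotProduct, dotProduct, Finset.mul_sum]
    refine Finset.sum_le_sum fun i _ => Nat.mul_le_mul ?_ (Nat.le_mul_of_pos_left _ (hφ i))
    exact Finset.single_le_sum (f := fun i => g (φ (Pi.single i 1))) (fun _ _ => Nat.zero_le _)
      (Finset.mem_univ i)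
  simp only [vadd_eq_add, map_add]
  nlinarith [Nat.zero_le (g b * (h b + h (φ u))), Nat.zero_le
    ((∑ i, g (φ (Pi.single i 1))) * (h b + 1))]

theorem IsSemilinearSet.exists_le_mul_height [IsCancelAdd M] [IsAddTorsionFree M] {s : Set M}
    (hs : IsSemilinearSet s) (h g : M →+ ℕ) (hfin : ∀ n, (s ∩ h ⁻¹' {n}).Finite) :
    ∃ c, ∀ x ∈ s, g x ≤ c * (h x + 1) := by
  obtain ⟨𝒮, h𝒮, hlin, rfl⟩ := hs
  have H : ∀ t, ∃ c, t ∈ 𝒮 → ∀ x ∈ t, g x ≤ c * (h x + 1) := by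
    intro t
    by_cases ht : t ∈ 𝒮
    · obtain ⟨c, hc⟩ := (hlin t ht).exists_le_mul_height h g fun n => (hfin n).subset
        (Set.inter_subset_inter_left _ (Set.subset_sUnion_of_mem ht))
      exact ⟨c, fun _ => hc⟩
    · exact ⟨0, fun h => absurd h ht⟩
  choose c hc using H
  obtain ⟨C, hC⟩ := (h𝒮.image c).bddAbove
  refine ⟨C, ?_⟩
  rintro x ⟨t, ht, hx⟩
  exact (hc t ht x hx).trans (Nat.mul_le_mul_right _ (hC (Set.mem_image_of_mem c ht)))

end Hybrid

section MonomialIdeal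

variable {k : Type} [Field k] {d : ℕ}

/-- The exponents of the monomials lying in an ideal. -/
def exponentSet (I : Ideal (MvPolynomial (Fin d) k)) : Set (Fin d →₀ ℕ) :=
  {a | monomial a (1 : k) ∈ I}

theorem add_mem_exponentSet {I J L : Ideal (MvPolynomial (Fin d) k)} (h : I * J ≤ L)
    {a b : Fin d →₀ ℕ} (ha : a ∈ exponentSet I) (hb : b ∈ exponentSet J) :
    a + b ∈ exponentSet L := by
  have := h (Ideal.mul_mem_mul ha hb)
  rwa [monomial_mul, one_mul] at this

theorem isUpperSet_exponentSet (I : Ideal (MvPolynomial (Fin d) k)) :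
    IsUpperSet (exponentSet I) := by
  intro a b hle ha
  obtain ⟨c, rfl⟩ := exists_add_of_le hle
  have hc : monomial c (1 : k) ∈ (⊤ : Ideal (MvPolynomial (Fin d) k)) := Submodule.mem_top
  exact add_mem_exponentSet (J := ⊤) (L := I) Ideal.mul_le_left ha hc

theorem IsMonomialIdeal.eq_span_exponentSet {I : Ideal (MvPolynomial (Fin d) k)}
    (hI : IsMonomialIdeal I) :
    I = Ideal.span ((fun a => (monomial a (1 : k) : MvPolynomial (Fin d) k)) '' exponentSet I) := by
  obtain ⟨S, rfl⟩ := hI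
  refine le_antisymm (Ideal.span_mono (Set.image_mono fun a ha => ?_)) (Ideal.span_le.2 ?_)
  · exact Ideal.subset_span ⟨a, ha, rfl⟩
  · rintro _ ⟨a, ha, rfl⟩
    exact ha

theorem exists_add_of_mem_exponentSet_sum_mul {ι : Type*} (s : Finset ι)
    {I J : ι → Ideal (MvPolynomial (Fin d) k)} (hI : ∀ i, IsMonomialIdeal (I i))
    (hJ : ∀ i, IsMonomialIdeal (J i)) {a : Fin d →₀ ℕ}
    (ha : a ∈ exponentSet (∑ i ∈ s, I i * J i)) :
    ∃ i ∈ s, ∃ b ∈ exponentSet (I i), ∃ c ∈ exponentSet (J i), a = b + c := by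
  have hle : ∑ i ∈ s, I i * J i ≤
      Ideal.span ((fun a => (monomial a (1 : k) : MvPolynomial (Fin d) k)) ''
        {a | ∃ i ∈ s, ∃ b ∈ exponentSet (I i), ∃ c ∈ exponentSet (J i), a = b + c}) := by
    rw [Ideal.sum_eq_sup]
    refine Finset.sup_le fun i hi => ?_
    rw [(hI i).eq_span_exponentSet, (hJ i).eq_span_exponentSet, Ideal.span_mul_span', Ideal.span_le]
    rintro _ ⟨_, ⟨b, hb, rfl⟩, _, ⟨c, hc, rfl⟩, rfl⟩
    refine Ideal.subset_span ⟨b + c, ⟨i, hi, b, hb, c, hc, rfl⟩, ?_⟩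
    simp [monomial_mul]
  obtain ⟨_, ⟨i, hi, b, hb, c, hc, rfl⟩, hle⟩ :=
    mem_ideal_span_monomial_image.1 (hle ha) a (by classical simp [support_monomial])
  obtain ⟨e, rfl⟩ := exists_add_of_le hle
  exact ⟨i, hi, b, hb, c + e, isUpperSet_exponentSet _ le_self_add hc, add_assoc b c e⟩

open scoped Pointwise in
theorem IsUpperSet.isSemilinearSet_image_prodMk {U : Set (Fin d →₀ ℕ)} (hU : IsUpperSet U)
    (n : ℕ) : IsSemilinearSet ((fun a => (a, n)) '' U) := by
  have : AddMonoid.FG (Fin d →₀ ℕ) := AddCommMonoid.fg_of_wellQuasiOrderedLE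
  obtain ⟨B, hB, -, rfl⟩ := hU.exists_finite_eq_biUnion_Ici
  have hsemi : IsSemilinearSet (⋃ b ∈ B, Set.Ici b) := by
    refine IsSemilinearSet.biUnion hB fun b _ => ?_
    have : Set.Ici b = b +ᵥ (Set.univ : Set (Fin d →₀ ℕ)) := by
      ext x
      simp [Set.mem_vadd_set, le_iff_exists_add, eq_comm]
    rw [this]
    exact IsSemilinearSet.univ.vadd b
  have himage : (fun a => (a, n)) '' (⋃ b ∈ B, Set.Ici b) =
      ((0, n) : (Fin d →₀ ℕ) × ℕ) +ᵥ AddMonoidHom.inl (Fin d →₀ ℕ) ℕ '' (⋃ b ∈ B, Set.Ici b) := by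
    rw [← Set.image_vadd, Set.image_image]
    simp
  rw [himage]
  exact (hsemi.image _).vadd _

theorem IsNoethGradedMonomialFamily.isSemilinearSet {I : ℕ → Ideal (MvPolynomial (Fin d) k)}
    (hI : IsNoethGradedMonomialFamily I) :
    IsSemilinearSet {x : (Fin d →₀ ℕ) × ℕ | x.1 ∈ exponentSet (I x.2)} := by
  obtain ⟨hmon, h0, hmul, N, -, hN⟩ := hI
  let P : AddSubmonoid ((Fin d →₀ ℕ) × ℕ) :=
    { carrier := {x | x.1 ∈ exponentSet (I x.2)}
      zero_mem' := by
        change monomial _ _ ∈ I 0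
        rw [h0]
        exact Submodule.mem_top
      add_mem' := fun ha hb => add_mem_exponentSet (hmul _ _) ha hb }
  let G : Set ((Fin d →₀ ℕ) × ℕ) :=
    ⋃ n ∈ Set.Iic N, (fun a => (a, n)) '' exponentSet (I n)
  have hG : ∀ n a, n ≤ N → a ∈ exponentSet (I n) → (a, n) ∈ G := fun n a hn ha =>
    Set.mem_biUnion (Set.mem_Iic.2 hn) ⟨a, ha, rfl⟩
  have hGsemi : IsSemilinearSet G := IsSemilinearSet.biUnion (Set.finite_Iic N) fun n _ =>
    (isUpperSet_exponentSet (I n)).isSemilinearSet_image_prodMk n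
  suffices hP : P = AddSubmonoid.closure G by
    change IsSemilinearSet (P : Set ((Fin d →₀ ℕ) × ℕ))
    rw [hP]
    exact hGsemi.closure
  refine le_antisymm ?_ (AddSubmonoid.closure_le.2 ?_)
  · rintro ⟨a, n⟩ (ha : a ∈ exponentSet (I n))
    induction n using Nat.strong_induction_on generalizing a with
    | _ n ih =>
      rcases le_or_gt n N with hn | hn
      · exact AddSubmonoid.subset_closure (hG n a hn ha)
      · rw [hN n hn] at ha
        obtain ⟨j, hj, b, hb, c, hc, rfl⟩ :=
          exists_add_of_mem_exponentSet_sum_mul _ hmon (fun j => hmon (n - j)) ha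
        rw [Finset.mem_Icc] at hj
        have hsplit : (b + c, n) = (b, j) + (c, n - j) := by
          rw [Prod.mk_add_mk, Nat.add_sub_cancel' (by omega)]
        rw [hsplit]
        exact add_mem (AddSubmonoid.subset_closure (hG j b hj.2 hb)) (ih _ (by omega) c hc)
  · rintro x hx
    obtain ⟨n, -, a, ha, rfl⟩ := Set.mem_iUnion₂.1 hx
    exact ha

end MonomialIdeal

open scoped Pointwise in
theorem isSemilinearSet_le_snd {M : Type*} [AddCommMonoid M] [AddMonoid.FG M]
    (N : ℕ) :
    IsSemilinearSet {x : M × ℕ | N ≤ x.2} := by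
  have h : {x : M × ℕ | N ≤ x.2} = ((0, N) : M × ℕ) +ᵥ (Set.univ : Set (M × ℕ)) := by
    ext x
    constructor
    · intro hx
      exact ⟨(x.1, x.2 - N), trivial, Prod.ext (zero_add _) (Nat.add_sub_cancel' hx)⟩
    · rintro ⟨y, -, rfl⟩
      exact Nat.le_add_right _ _
  rw [h]
  exact IsSemilinearSet.univ.vadd _

theorem ncard_le_pow_of_apply_le {d c : ℕ} {s : Set (Fin d →₀ ℕ)} (hs : ∀ a ∈ s, ∀ i, a i ≤ c) :
    s.ncard ≤ (c + 1) ^ d := by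
  have h := Set.ncard_le_ncard (s := (fun a : Fin d →₀ ℕ => (a : Fin d → ℕ)) '' s)
    (t := Set.Iic fun _ => c) (by rintro _ ⟨a, ha, rfl⟩ i; exact hs a ha i) (Set.finite_Iic _)
  rw [DFunLike.coe_injective.injOn.ncard_image] at h
  refine h.trans_eq ?_
  rw [← Finset.coe_Iic, Set.ncard_coe_finset, Pi.card_Iic]
  simp

/-- Given Noetherian graded families of monomial ideals `(I_{i,n})_{1 ≤ i ≤ r}` and
`(J_{j,n})_{1 ≤ j ≤ s}`, the counting function
`f(n) = #{a ∈ ℕ^d : x^a ∈ I_{i,n} ∀ i, x^a ∉ J_{j,n} ∀ j}`, if eventually finite,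
eventually agrees with a quasi-polynomial of degree at most `d`. -/
theorem counting_function_noetherian_graded_families_eventually_quasipolynomial
    (k : Type) [Field k] (d : ℕ) (hd : 1 ≤ d) (r s : ℕ)
    (I : Fin r → ℕ → Ideal (MvPolynomial (Fin d) k))
    (J : Fin s → ℕ → Ideal (MvPolynomial (Fin d) k))
    (hI : ∀ i, IsNoethGradedMonomialFamily (I i))
    (hJ : ∀ j, IsNoethGradedMonomialFamily (J j))
    (S : ℕ → Set (Fin d →₀ ℕ))
    (hS : ∀ n, S n = {a : Fin d →₀ ℕ |
      (∀ i, (monomial a (1 : k) : MvPolynomial (Fin d) k) ∈ I i n) ∧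
      (∀ j, (monomial a (1 : k) : MvPolynomial (Fin d) k) ∉ J j n)})
    (N₀ : ℕ) (hfin : ∀ n, N₀ ≤ n → (S n).Finite) :
    ∃ (N π : ℕ), 1 ≤ π ∧ ∃ p : ℕ → Polynomial ℚ,
      (∀ j, j < π → (p j).natDegree ≤ d) ∧
      ∀ n, N ≤ n → ((S n).ncard : ℚ) = (p (n % π)).eval (n : ℚ) := by
  have : AddMonoid.FG (Fin d →₀ ℕ) := AddCommMonoid.fg_of_wellQuasiOrderedLE
  let h : (Fin d →₀ ℕ) × ℕ →+ ℕ := AddMonoidHom.snd _ _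
  let T : Set ((Fin d →₀ ℕ) × ℕ) := {x | N₀ ≤ x.2 ∧ x.1 ∈ S x.2}
  have hfibre : ∀ n, N₀ ≤ n → T ∩ h ⁻¹' {n} = (fun a => (a, n)) '' S n := by
    intro n hn
    ext ⟨a, m⟩
    simp only [T, h, Set.mem_inter_iff, Set.mem_ofPred_eq, Set.mem_preimage, AddMonoidHom.coe_snd,
      Set.mem_singleton_iff, Set.mem_image, Prod.mk.injEq]
    constructor
    · rintro ⟨⟨-, ha⟩, rfl⟩
      exact ⟨a, ha, rfl, rfl⟩
    · rintro ⟨_, ha, rfl, rfl⟩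
      exact ⟨⟨hn, ha⟩, rfl⟩
  have hTfin : ∀ n, (T ∩ h ⁻¹' {n}).Finite := by
    intro n
    rcases le_or_gt N₀ n with hn | hn
    · rw [hfibre n hn]
      exact (hfin n hn).image _
    · refine Set.finite_empty.subset ?_
      rintro ⟨a, m⟩ ⟨hx, rfl⟩
      exact absurd hx.1 (not_le.2 hn)
  have hTsemi : IsSemilinearSet T := by
    have hT : T = {x | N₀ ≤ x.2} ∩ ((⋂ i, {x | x.1 ∈ exponentSet (I i x.2)}) ∩
        ⋂ j, {x | x.1 ∈ exponentSet (J j x.2)}ᶜ) := by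
      ext x
      simp only [T, hS, Set.mem_ofPred_eq, Set.mem_inter_iff, Set.mem_iInter, Set.mem_compl_iff,
        exponentSet]
    rw [hT]
    exact (isSemilinearSet_le_snd N₀).inter ((IsSemilinearSet.iInter fun i =>
      (hI i).isSemilinearSet).inter (IsSemilinearSet.iInter fun j => (hJ j).isSemilinearSet.compl))
  have hcard : ∀ n, N₀ ≤ n → (T ∩ h ⁻¹' {n}).ncard = (S n).ncard := by
    intro n hn
    rw [hfibre n hn, Set.ncard_image_of_injective _ (Prod.mk_left_injective n)]
  obtain ⟨N, q, hq, p, hp⟩ := (hTsemi.hasQuasiPolyCount h hTfin).2.exists_polynomial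
  obtain ⟨c, hc⟩ := hTsemi.exists_le_mul_height h
    (Finsupp.degree.comp (AddMonoidHom.fst (Fin d →₀ ℕ) ℕ)) hTfin
  have hp' : ∀ n, N + N₀ + 1 ≤ n → ((S n).ncard : ℚ) = (p (n % q)).eval (n : ℚ) := by
    intro n hn
    rw [← hcard n (by omega)]
    exact hp n (by omega)
  refine ⟨N + N₀ + 1, q, hq, p, fun j hj => ?_, hp'⟩
  refine natDegree_le_of_abs_eval_le_on_progression (c := (2 * c + 1 : ℚ) ^ d)
    (N := N + N₀ + 1) hq ?_ hj
  rintro n hn rfl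
  rw [← hp' n hn, Nat.abs_cast, ← mul_pow]
  have hbound : (S n).ncard ≤ ((2 * c + 1) * n) ^ d := by
    refine (ncard_le_pow_of_apply_le (c := c * (n + 1)) fun a ha i => ?_).trans
      (Nat.pow_le_pow_left (by nlinarith) d)
    exact (Finsupp.le_degree i a).trans (hc (a, n) ⟨by omega, ha⟩)
  exact_mod_cast hbound
end

section
/- Let F ⊆ {1,…,d} and let I, J be monomial ideals of R. Then the ideal of R generated by π_F(I ∩ J) equals the intersection of the ideal generated by π_F(I) with the ideal generated by π_F(J); that is, (I ∩ J)_F = I_F ∩ J_F. -/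
open MvPolynomial

/-- The `k`-algebra homomorphism `π_F : R → R` sending `x_i ↦ 1` for `i ∈ F` and
`x_i ↦ x_i` for `i ∉ F`. -/
noncomputable def piF (k : Type) [Field k] (d : ℕ) (F : Finset (Fin d)) :
    MvPolynomial (Fin d) k →ₐ[k] MvPolynomial (Fin d) k :=
  aeval fun i => if i ∈ F then 1 else X i

theorem piF_monomial (k : Type) [Field k] (d : ℕ) (F : Finset (Fin d)) (a : Fin d →₀ ℕ) :
    piF k d F (monomial a 1) = monomial (a.filter (· ∉ F)) 1 := by
  rw [piF, aeval_monomial, map_one, one_mul, monomial_eq, C_1, one_mul,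
    Finsupp.prod_fintype _ _ (by simp), Finsupp.prod_fintype _ _ (by simp)]
  refine Finset.prod_congr rfl fun i _ => ?_
  by_cases hi : i ∈ F <;> simp [hi]

theorem map_piF_span_monomial (k : Type) [Field k] (d : ℕ) (F : Finset (Fin d))
    (S : Set (Fin d →₀ ℕ)) :
    Ideal.map (piF k d F) (Ideal.span ((fun a => monomial a (1 : k)) '' S)) =
      Ideal.span ((fun a => monomial a (1 : k)) ''
        ((fun a => a.filter (· ∉ F)) '' S)) := by
  simp only [Ideal.map_span, Set.image_image, piF_monomial]

theorem monomial_mem_span_monomial (k : Type) [Field k] {d : ℕ} {S : Set (Fin d →₀ ℕ)}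
    {a b : Fin d →₀ ℕ} (ha : a ∈ S) (hab : a ≤ b) :
    monomial b (1 : k) ∈ Ideal.span ((fun a => monomial a (1 : k)) '' S) := by
  rw [mem_ideal_span_monomial_image]
  intro c hc
  rw [Finset.mem_singleton.mp (support_monomial_subset hc)]
  exact ⟨a, ha, hab⟩

/-- For monomial ideals `I, J` and `F ⊆ {1, …, d}`, one has `(I ∩ J)_F = I_F ∩ J_F`,
where `I_F` is the ideal generated by `π_F(I)`. -/
theorem map_piF_inf_of_monomial (k : Type) [Field k] (d : ℕ) (hd : 1 ≤ d)
    (F : Finset (Fin d)) (I J : Ideal (MvPolynomial (Fin d) k))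
    (hI : IsMonomialIdeal I) (hJ : IsMonomialIdeal J) :
    Ideal.map (piF k d F) (I ⊓ J) =
      Ideal.map (piF k d F) I ⊓ Ideal.map (piF k d F) J := by
  obtain ⟨S, rfl⟩ := hI
  obtain ⟨T, rfl⟩ := hJ
  refine le_antisymm (le_inf (Ideal.map_mono inf_le_left) (Ideal.map_mono inf_le_right)) ?_
  rintro x ⟨hxS, hxT⟩
  rw [SetLike.mem_coe, map_piF_span_monomial, mem_ideal_span_monomial_image] at hxS hxT
  have hx : x ∈ Ideal.map (piF k d F)
      (Ideal.span ((fun a => monomial a (1 : k)) '' Set.image2 (· ⊔ ·) S T)) := by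
    rw [map_piF_span_monomial, mem_ideal_span_monomial_image]
    intro m hm
    obtain ⟨_, ⟨a, ha, rfl⟩, ham⟩ := hxS m hm
    obtain ⟨_, ⟨b, hb, rfl⟩, hbm⟩ := hxT m hm
    refine ⟨_, ⟨a ⊔ b, ⟨a, ha, b, hb, rfl⟩, rfl⟩, fun i => ?_⟩
    have hai := ham i
    have hbi := hbm i
    by_cases hi : i ∈ F <;> simp_all
  refine Ideal.map_mono (Ideal.span_le.mpr ?_) hx
  rintro _ ⟨_, ⟨a, ha, b, hb, rfl⟩, rfl⟩
  exact ⟨monomial_mem_span_monomial k ha le_sup_left,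
    monomial_mem_span_monomial k hb le_sup_right⟩
end

section
/- Let I_1, …, I_r, J_1, …, J_s be nonzero monomial ideals of R. For every n ≥ 1 let S_n = {a ∈ ℕ^d : a ∈ n·conv(I_i) for every 1 ≤ i ≤ r, and a ∉ n·conv(J_j) for every 1 ≤ j ≤ s} (equivalently, S_n = {a ∈ ℕ^d : x^a ∈ \overline{I_i^n} for all i and x^a ∉ \overline{J_j^n} for all j}). Assume |S_n| < ∞ for all sufficiently large n. Then the limit lim_{n→∞} |S_n|/n^d exists and is a rational number. -/
open MvPolynomial Filter

/-- The Newton polyhedron `conv(I) ⊆ ℝ^d` of a monomial ideal `I`: the convex hull of the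
exponent vectors of the monomials lying in `I`. -/
noncomputable def newtonPolyhedron (k : Type) [Field k] (d : ℕ)
    (I : Ideal (MvPolynomial (Fin d) k)) : Set (Fin d → ℝ) :=
  convexHull ℝ ((fun (a : Fin d →₀ ℕ) (i : Fin d) => (a i : ℝ)) ''
    {a : Fin d →₀ ℕ | (monomial a (1 : k) : MvPolynomial (Fin d) k) ∈ I})

/-- The value at `x` of the affine function with linear coefficients `c` and constant term `b`,
all rational. -/
noncomputable def rationalAffine {d : ℕ} (c : Fin d → ℚ) (b : ℚ) (x : Fin d → ℝ) : ℝ :=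
  ∑ i, (c i : ℝ) * x i + b

/-- The algebra of functions generated over `ℚ` by the coordinates and the indicators of rational
half-spaces: the piecewise polynomial functions with rational data. -/
noncomputable def rationalPiecewise (d : ℕ) : Subalgebra ℚ ((Fin d → ℝ) → ℝ) :=
  Algebra.adjoin ℚ (Set.range (fun i x => x i) ∪
    {f | ∃ c b, f = Set.indicator {x | 0 ≤ rationalAffine c b x} 1})

namespace rationalPiecewise

variable {d : ℕ}

lemma coord_mem (i : Fin d) : (fun x : Fin d → ℝ => x i) ∈ rationalPiecewise d :=
  Algebra.subset_adjoin (Or.inl ⟨i, rfl⟩)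

lemma indicator_mem (c : Fin d → ℚ) (b : ℚ) :
    Set.indicator {x | 0 ≤ rationalAffine c b x} 1 ∈ rationalPiecewise d :=
  Algebra.subset_adjoin (Or.inr ⟨c, b, rfl⟩)

lemma const_mem (q : ℚ) : (fun _ => (q : ℝ)) ∈ rationalPiecewise d :=
  (rationalPiecewise d).algebraMap_mem q

lemma affine_mem (c : Fin d → ℚ) (b : ℚ) : rationalAffine c b ∈ rationalPiecewise d := by
  have : rationalAffine c b =
      ∑ i, (fun _ : Fin d → ℝ => (c i : ℝ)) * (fun x => x i) + fun _ => (b : ℝ) := by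
    ext x
    simp [rationalAffine]
  rw [this]
  exact add_mem (sum_mem fun i _ => mul_mem (const_mem _) (coord_mem i)) (const_mem _)

lemma continuous_affine (c : Fin d → ℚ) (b : ℚ) : Continuous (rationalAffine c b) := by
  unfold rationalAffine
  fun_prop

lemma measurable_of_mem {f : (Fin d → ℝ) → ℝ} (hf : f ∈ rationalPiecewise d) : Measurable f := by
  induction hf using Algebra.adjoin_induction with
  | mem f hf =>
    rcases hf with ⟨i, rfl⟩ | ⟨c, b, rfl⟩
    · exact measurable_pi_apply i
    · exact measurable_one.indicator
        (measurableSet_le measurable_const (continuous_affine c b).measurable)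
  | algebraMap r => exact measurable_const
  | add f g _ _ hf hg => exact hf.add hg
  | mul f g _ _ hf hg => exact hf.mul hg

lemma bounded_of_mem {f : (Fin d → ℝ) → ℝ} (hf : f ∈ rationalPiecewise d) (M : ℝ) :
    ∃ C, ∀ x, (∀ i, x i ∈ Set.Icc 0 M) → |f x| ≤ C := by
  induction hf using Algebra.adjoin_induction with
  | mem f hf =>
    rcases hf with ⟨i, rfl⟩ | ⟨c, b, rfl⟩
    · exact ⟨M, fun x hx => abs_le.2 ⟨by linarith [(hx i).1, (hx i).2], (hx i).2⟩⟩
    · refine ⟨1, fun x _ => ?_⟩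
      by_cases h : 0 ≤ rationalAffine c b x <;> simp [Set.indicator, h]
  | algebraMap r => exact ⟨|(r : ℝ)|, fun x _ => le_rfl⟩
  | add f g _ _ hf hg =>
    obtain ⟨C, hC⟩ := hf
    obtain ⟨D, hD⟩ := hg
    exact ⟨C + D, fun x hx => (abs_add_le _ _).trans (add_le_add (hC x hx) (hD x hx))⟩
  | mul f g _ _ hf hg =>
    obtain ⟨C, hC⟩ := hf
    obtain ⟨D, hD⟩ := hg
    refine ⟨C * D, fun x hx => ?_⟩
    rw [Pi.mul_apply, abs_mul]
    exact mul_le_mul (hC x hx) (hD x hx) (abs_nonneg _) ((abs_nonneg _).trans (hC x hx))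

/-- Gluing two members along a rational hyperplane. -/
lemma ite_mem {f g : (Fin d → ℝ) → ℝ} (hf : f ∈ rationalPiecewise d)
    (hg : g ∈ rationalPiecewise d) (c : Fin d → ℚ) (b : ℚ) :
    (fun x => if 0 ≤ rationalAffine c b x then f x else g x) ∈ rationalPiecewise d := by
  have : (fun x => if 0 ≤ rationalAffine c b x then f x else g x) =
      Set.indicator {x | 0 ≤ rationalAffine c b x} 1 * (f - g) + g := by
    ext x
    by_cases h : 0 ≤ rationalAffine c b x <;> simp [Set.indicator, h]
  rw [this]
  exact add_mem (mul_mem (indicator_mem c b) (sub_mem hf hg)) hg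

end rationalPiecewise

lemma intervalIntegral_indicator_Iic {h : ℝ → ℝ} (a b u : ℝ) :
    ∫ t in a..b, (Set.Iic u).indicator h t = ∫ t in (min a u)..(min b u), h t := by
  wlog hab : a ≤ b generalizing a b
  · rw [intervalIntegral.integral_symm, this b a (le_of_not_ge hab),
      ← intervalIntegral.integral_symm]
  rw [intervalIntegral.integral_of_le hab,
    intervalIntegral.integral_of_le (min_le_min_right u hab),
    MeasureTheory.setIntegral_indicator measurableSet_Iic]
  congr 2
  ext t
  simp only [Set.mem_inter_iff, Set.mem_Ioc, Set.mem_Iic, le_min_iff, min_lt_iff]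
  constructor
  · rintro ⟨⟨h1, h2⟩, h3⟩
    exact ⟨Or.inl h1, h2, h3⟩
  · rintro ⟨h1, h2, h3⟩
    exact ⟨⟨h1.resolve_right (not_lt.2 h3), h2⟩, h3⟩

lemma intervalIntegral_indicator_Ici {h : ℝ → ℝ}
    (hh : ∀ a b, IntervalIntegrable h MeasureTheory.volume a b) (a b u : ℝ) :
    ∫ t in a..b, (Set.Ici u).indicator h t =
      (∫ t in a..b, h t) - ∫ t in (min a u)..(min b u), h t := by
  have hind : ∀ᵐ t : ℝ, (Set.Ici u).indicator h t = h t - (Set.Iic u).indicator h t := by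
    filter_upwards [MeasureTheory.Measure.ae_ne MeasureTheory.volume u] with t ht
    rcases lt_or_gt_of_ne ht with h1 | h1
    · simp [Set.indicator, h1.le, not_le.2 h1]
    · simp [Set.indicator, h1.le, not_le.2 h1]
  rw [← intervalIntegral_indicator_Iic, ← intervalIntegral.integral_sub (hh a b)]
  · exact intervalIntegral.integral_congr_ae (hind.mono fun t ht _ => ht)
  · exact ⟨(hh a b).1.indicator measurableSet_Iic, (hh a b).2.indicator measurableSet_Iic⟩

section Slice

variable {d : ℕ}

lemma rationalAffine_sub (c c' : Fin d → ℚ) (b b' : ℚ) (x : Fin d → ℝ) :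
    rationalAffine (c - c') (b - b') x = rationalAffine c b x - rationalAffine c' b' x := by
  simp only [rationalAffine, Pi.sub_apply, Rat.cast_sub, sub_mul, Finset.sum_sub_distrib]
  ring

lemma rationalAffine_smul (q : ℚ) (c : Fin d → ℚ) (b : ℚ) (x : Fin d → ℝ) :
    rationalAffine (q • c) (q * b) x = q * rationalAffine c b x := by
  simp only [rationalAffine, Pi.smul_apply, smul_eq_mul, Rat.cast_mul, mul_add, Finset.mul_sum,
    mul_assoc]

lemma rationalAffine_const (b : ℚ) (x : Fin d → ℝ) : rationalAffine 0 b x = b := by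
  simp [rationalAffine]

lemma rationalAffine_cons (c : Fin (d + 1) → ℚ) (b : ℚ) (t : ℝ) (x : Fin d → ℝ) :
    rationalAffine c b (Fin.cons t x) = c 0 * t + rationalAffine (Fin.tail c) b x := by
  simp [rationalAffine, Fin.sum_univ_succ, Fin.tail, add_assoc]

lemma rationalAffine_cons_of_ne_zero {c : Fin (d + 1) → ℚ} (hc : c 0 ≠ 0) (b : ℚ) (t : ℝ)
    (x : Fin d → ℝ) : rationalAffine c b (Fin.cons t x) =
      c 0 * (t - rationalAffine ((-(c 0)⁻¹) • Fin.tail c) (-(c 0)⁻¹ * b) x) := by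
  have hr : (c 0 : ℝ) ≠ 0 := by exact_mod_cast hc
  rw [rationalAffine_cons, rationalAffine_smul]
  push_cast
  field_simp
  ring

/-- `h` can be integrated, together with its moments, in the first coordinate from `0` to any
rational affine function of the remaining ones, with piecewise polynomial result. -/
structure SliceIntegrable (h : (Fin (d + 1) → ℝ) → ℝ) : Prop where
  integrable : ∀ (x : Fin d → ℝ) (n : ℕ) (a b : ℝ),
    IntervalIntegrable (fun t => t ^ n * h (Fin.cons t x)) MeasureTheory.volume a b
  mem : ∀ (n : ℕ) (c : Fin d → ℚ) (b : ℚ),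
    (fun x => ∫ t in (0 : ℝ)..rationalAffine c b x, t ^ n * h (Fin.cons t x)) ∈
      rationalPiecewise d

namespace SliceIntegrable

variable {g h : (Fin (d + 1) → ℝ) → ℝ}

lemma one : SliceIntegrable (1 : (Fin (d + 1) → ℝ) → ℝ) where
  integrable x n a b := by
    refine Continuous.intervalIntegrable ?_ a b
    simp only [Pi.one_apply, mul_one]
    fun_prop
  mem n c b := by
    have : (fun x => ∫ t in (0 : ℝ)..rationalAffine c b x,
          t ^ n * (1 : (Fin (d + 1) → ℝ) → ℝ) (Fin.cons t x)) =
        (fun _ => (((n + 1 : ℚ)⁻¹ : ℚ) : ℝ)) * rationalAffine c b ^ (n + 1) := by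
      ext x
      simp [integral_pow]
      ring
    rw [this]
    exact mul_mem (rationalPiecewise.const_mem _)
      (pow_mem (rationalPiecewise.affine_mem c b) _)

lemma add (hg : SliceIntegrable g) (hh : SliceIntegrable h) : SliceIntegrable (g + h) where
  integrable x n a b := by
    simpa only [Pi.add_apply, mul_add] using (hg.integrable x n a b).add (hh.integrable x n a b)
  mem n c b := by
    convert add_mem (hg.mem n c b) (hh.mem n c b) using 1
    ext x
    simp only [Pi.add_apply, mul_add]
    exact intervalIntegral.integral_add (hg.integrable x n _ _) (hh.integrable x n _ _)

lemma mul_tail (hh : SliceIntegrable h) {f : (Fin d → ℝ) → ℝ} (hf : f ∈ rationalPiecewise d)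
    (hgf : ∀ t x, g (Fin.cons t x) = f x) : SliceIntegrable (g * h) where
  integrable x n a b := by
    simpa only [Pi.mul_apply, hgf, mul_left_comm] using (hh.integrable x n a b).const_mul (f x)
  mem n c b := by
    convert mul_mem hf (hh.mem n c b) using 1
    ext x
    simp only [Pi.mul_apply, hgf, mul_left_comm _ (f x), intervalIntegral.integral_const_mul]

lemma mul_head (hh : SliceIntegrable h) : SliceIntegrable ((fun y => y 0) * h) where
  integrable x n a b := by
    simpa only [Pi.mul_apply, Fin.cons_zero, pow_succ, mul_assoc] using hh.integrable x (n + 1) a b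
  mem n c b := by
    simpa only [Pi.mul_apply, Fin.cons_zero, pow_succ, mul_assoc] using hh.mem (n + 1) c b

lemma mem_min (hh : SliceIntegrable h) (n : ℕ) (c c' : Fin d → ℚ) (b b' : ℚ) :
    (fun x => ∫ t in (min 0 (rationalAffine c' b' x))..
        (min (rationalAffine c b x) (rationalAffine c' b' x)), t ^ n * h (Fin.cons t x)) ∈
      rationalPiecewise d := by
  have key : ∀ (c : Fin d → ℚ) (b : ℚ),
      (fun x => ∫ t in (0 : ℝ)..(min (rationalAffine c b x) (rationalAffine c' b' x)),
        t ^ n * h (Fin.cons t x)) ∈ rationalPiecewise d := by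
    intro c b
    convert rationalPiecewise.ite_mem (hh.mem n c b) (hh.mem n c' b') (c' - c) (b' - b) using 1
    ext x
    rw [rationalAffine_sub]
    split_ifs with hx
    · rw [min_eq_left (by linarith)]
    · rw [min_eq_right (by linarith)]
  convert sub_mem (key c b) (key 0 0) using 1
  ext x
  rw [Pi.sub_apply, rationalAffine_const, Rat.cast_zero,
    intervalIntegral.integral_interval_sub_left (hh.integrable x n _ _) (hh.integrable x n _ _)]

lemma mul_indicator (hh : SliceIntegrable h) (c : Fin (d + 1) → ℚ) (b : ℚ) :
    SliceIntegrable (Set.indicator {x | 0 ≤ rationalAffine c b x} 1 * h) := by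
  rcases lt_trichotomy (c 0) 0 with h0 | h0 | h0
  · have hr : (c 0 : ℝ) < 0 := by exact_mod_cast h0
    have key : ∀ (x : Fin d → ℝ) (n : ℕ),
        (fun t => t ^ n *
          (Set.indicator {x | 0 ≤ rationalAffine c b x} 1 * h : (Fin (d + 1) → ℝ) → ℝ)
            (Fin.cons t x)) =
        (Set.Iic (rationalAffine ((-(c 0)⁻¹) • Fin.tail c) (-(c 0)⁻¹ * b) x)).indicator
          (fun t => t ^ n * h (Fin.cons t x)) := by
      intro x n
      ext t
      have : 0 ≤ rationalAffine c b (Fin.cons t x) ↔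
          t ≤ rationalAffine ((-(c 0)⁻¹) • Fin.tail c) (-(c 0)⁻¹ * b) x := by
        rw [rationalAffine_cons_of_ne_zero h0.ne]
        constructor <;> intro <;> nlinarith
      by_cases ht : 0 ≤ rationalAffine c b (Fin.cons t x)
      · simp only [Pi.mul_apply, Set.indicator, Set.mem_ofPred_eq, ht, this.1 ht,
          Set.Iic, if_true, Pi.one_apply, one_mul]
      · simp only [Pi.mul_apply, Set.indicator, Set.mem_ofPred_eq, ht, mt this.2 ht,
          Set.Iic, if_false, zero_mul, mul_zero]
    refine ⟨fun x n a b => ?_, fun n c b => ?_⟩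
    · rw [key]
      exact ⟨(hh.integrable x n a b).1.indicator measurableSet_Iic,
        (hh.integrable x n a b).2.indicator measurableSet_Iic⟩
    · simp only [key, intervalIntegral_indicator_Iic]
      exact hh.mem_min n _ _ _ _
  · refine hh.mul_tail (rationalPiecewise.indicator_mem (Fin.tail c) b) fun t x => ?_
    simp [Set.indicator, rationalAffine_cons, h0]
  · have hr : (0 : ℝ) < c 0 := by exact_mod_cast h0
    have key : ∀ (x : Fin d → ℝ) (n : ℕ),
        (fun t => t ^ n *
          (Set.indicator {x | 0 ≤ rationalAffine c b x} 1 * h : (Fin (d + 1) → ℝ) → ℝ)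
            (Fin.cons t x)) =
        (Set.Ici (rationalAffine ((-(c 0)⁻¹) • Fin.tail c) (-(c 0)⁻¹ * b) x)).indicator
          (fun t => t ^ n * h (Fin.cons t x)) := by
      intro x n
      ext t
      have : 0 ≤ rationalAffine c b (Fin.cons t x) ↔
          rationalAffine ((-(c 0)⁻¹) • Fin.tail c) (-(c 0)⁻¹ * b) x ≤ t := by
        rw [rationalAffine_cons_of_ne_zero h0.ne', mul_nonneg_iff_of_pos_left hr, sub_nonneg]
      by_cases ht : 0 ≤ rationalAffine c b (Fin.cons t x)
      · simp only [Pi.mul_apply, Set.indicator, Set.mem_ofPred_eq, ht, this.1 ht,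
          Set.Ici, if_true, Pi.one_apply, one_mul]
      · simp only [Pi.mul_apply, Set.indicator, Set.mem_ofPred_eq, ht, mt this.2 ht,
          Set.Ici, if_false, zero_mul, mul_zero]
    refine ⟨fun x n a b => ?_, fun n c b => ?_⟩
    · rw [key]
      exact ⟨(hh.integrable x n a b).1.indicator measurableSet_Ici,
        (hh.integrable x n a b).2.indicator measurableSet_Ici⟩
    · simp only [key, intervalIntegral_indicator_Ici (hh.integrable _ n)]
      exact sub_mem (hh.mem n _ _) (hh.mem_min n _ _ _ _)

lemma mul_of_mem (hg : g ∈ rationalPiecewise (d + 1)) :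
    ∀ h, SliceIntegrable h → SliceIntegrable (g * h) := by
  induction hg using Algebra.adjoin_induction with
  | mem f hf =>
    intro h hh
    rcases hf with ⟨i, rfl⟩ | ⟨c, b, rfl⟩
    · cases i using Fin.cases with
      | zero => exact hh.mul_head
      | succ i => exact hh.mul_tail (rationalPiecewise.coord_mem i) fun t x => by simp
    · exact hh.mul_indicator c b
  | algebraMap r => exact fun h hh => hh.mul_tail (rationalPiecewise.const_mem r) fun t x => rfl
  | add f g _ _ hf hg => exact fun h hh => add_mul f g h ▸ (hf h hh).add (hg h hh)
  | mul f g _ _ hf hg => exact fun h hh => mul_assoc f g h ▸ hf _ (hg h hh)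

lemma of_mem (hg : g ∈ rationalPiecewise (d + 1)) : SliceIntegrable g := by
  simpa using mul_of_mem hg 1 one

end SliceIntegrable

end Slice

lemma rationalPiecewise.integrable_of_mem {d : ℕ} {f : (Fin d → ℝ) → ℝ}
    (hf : f ∈ rationalPiecewise d) (M : ℝ) :
    MeasureTheory.Integrable f (MeasureTheory.Measure.pi
      fun _ : Fin d => MeasureTheory.volume.restrict (Set.Icc 0 M)) := by
  obtain ⟨C, hC⟩ := bounded_of_mem hf M
  refine MeasureTheory.Integrable.of_bound (measurable_of_mem hf).aestronglyMeasurable C ?_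
  rw [← MeasureTheory.Measure.restrict_pi_pi]
  refine MeasureTheory.ae_restrict_of_forall_mem
    (MeasurableSet.univ_pi fun _ => measurableSet_Icc) fun x hx => ?_
  exact hC x fun i => hx i (Set.mem_univ i)

theorem rationalPiecewise.exists_rat_integral {d : ℕ} {f : (Fin d → ℝ) → ℝ}
    (hf : f ∈ rationalPiecewise d) (M : ℕ) :
    ∃ q : ℚ, ∫ x, f x ∂(MeasureTheory.Measure.pi
      fun _ : Fin d => MeasureTheory.volume.restrict (Set.Icc (0 : ℝ) M)) = q := by
  induction d with
  | zero =>
    have : ∀ x, ∃ q : ℚ, f x = q := by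
      induction hf using Algebra.adjoin_induction with
      | mem f hf =>
        rcases hf with ⟨i, rfl⟩ | ⟨c, b, rfl⟩
        · exact i.elim0
        · intro x
          by_cases h : 0 ≤ rationalAffine c b x
          · exact ⟨1, by simp [Set.indicator, h]⟩
          · exact ⟨0, by simp [Set.indicator, h]⟩
      | algebraMap r => exact fun _ => ⟨r, rfl⟩
      | add f g _ _ hf hg =>
        intro x
        obtain ⟨p, hp⟩ := hf x
        obtain ⟨q, hq⟩ := hg x
        exact ⟨p + q, by simp [hp, hq]⟩
      | mul f g _ _ hf hg =>
        intro x
        obtain ⟨p, hp⟩ := hf x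
        obtain ⟨q, hq⟩ := hg x
        exact ⟨p * q, by simp [hp, hq]⟩
    obtain ⟨q, hq⟩ := this default
    refine ⟨q, ?_⟩
    rw [← hq, MeasureTheory.integral_unique]
    simp only [MeasureTheory.measureReal_def, MeasureTheory.Measure.pi_univ,
      Finset.univ_eq_empty, Finset.prod_empty, ENNReal.toReal_one, one_smul]
    exact congrArg f (Subsingleton.elim _ _)
  | succ d ih =>
    have hmp := (MeasureTheory.measurePreserving_piFinSuccAbove
      (fun _ : Fin (d + 1) => MeasureTheory.volume.restrict (Set.Icc (0 : ℝ) M)) 0).symm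
    obtain ⟨q, hq⟩ := ih ((SliceIntegrable.of_mem hf).mem 0 0 M)
    refine ⟨q, ?_⟩
    rw [← hq, ← hmp.integral_comp', MeasureTheory.integral_prod_symm]
    · congr 1
      ext x
      rw [rationalAffine_const, Rat.cast_natCast, intervalIntegral.integral_of_le (by positivity),
        ← MeasureTheory.integral_Icc_eq_integral_Ioc]
      simp [MeasurableEquiv.piFinSuccAbove_symm_apply, Fin.insertNthEquiv]
    · exact hmp.integrable_comp_of_integrable (integrable_of_mem hf M)

section RationalCone

variable {d : ℕ}

/-- The homogenization of `rationalAffine`: a rational linear form in `d + 1` variables. -/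
noncomputable def rationalForm (p : (Fin d → ℚ) × ℚ) (z : (Fin d → ℝ) × ℝ) : ℝ :=
  ∑ i, (p.1 i : ℝ) * z.1 i + p.2 * z.2

lemma rationalForm_one (p : (Fin d → ℚ) × ℚ) (x : Fin d → ℝ) :
    rationalForm p (x, 1) = rationalAffine p.1 p.2 x := by
  simp [rationalForm, rationalAffine]

lemma rationalForm_sub_smul (p : (Fin d → ℚ) × ℚ) (z v : (Fin d → ℝ) × ℝ) (t : ℝ) :
    rationalForm p (z - t • v) = rationalForm p z - t * rationalForm p v := by
  simp only [rationalForm, Prod.fst_sub, Prod.snd_sub, Prod.smul_fst, Prod.smul_snd,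
    Pi.sub_apply, Pi.smul_apply, smul_eq_mul, mul_sub, Finset.sum_sub_distrib, mul_add,
    Finset.mul_sum, mul_left_comm t]
  ring

lemma rationalForm_smul_sub_smul (a b : ℚ) (p q : (Fin d → ℚ) × ℚ) (z : (Fin d → ℝ) × ℝ) :
    rationalForm (a • p - b • q) z = a * rationalForm p z - b * rationalForm q z := by
  simp only [rationalForm, Prod.fst_sub, Prod.snd_sub, Prod.smul_fst, Prod.smul_snd,
    Pi.sub_apply, Pi.smul_apply, smul_eq_mul, sub_mul, Finset.sum_sub_distrib, mul_add,
    Finset.mul_sum, mul_assoc, Rat.cast_sub, Rat.cast_mul]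
  ring

/-- A cone cut out by finitely many rational homogeneous linear inequalities. -/
def IsRationalCone (K : Set ((Fin d → ℝ) × ℝ)) : Prop :=
  ∃ L : Finset ((Fin d → ℚ) × ℚ), K = {z | ∀ p ∈ L, 0 ≤ rationalForm p z}

/-- Fourier–Motzkin elimination: adding a generator to a rational cone. -/
lemma IsRationalCone.add_ray {K : Set ((Fin d → ℝ) × ℝ)} (hK : IsRationalCone K)
    {v : (Fin d → ℝ) × ℝ} (hv : ∀ p, ∃ q : ℚ, rationalForm p v = q) :
    IsRationalCone {z | ∃ t : ℝ, 0 ≤ t ∧ z - t • v ∈ K} := by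
  classical
  obtain ⟨L, rfl⟩ := hK
  choose e he using hv
  refine ⟨L.filter (fun p => 0 ≤ e p) ∪
    ((L.filter (fun p => 0 < e p)) ×ˢ (L.filter (fun p => e p < 0))).image
      (fun pq => e pq.1 • pq.2 - e pq.2 • pq.1), ?_⟩
  ext z
  simp only [Set.mem_ofPred_eq, rationalForm_sub_smul, he, Finset.mem_union, Finset.mem_filter,
    Finset.mem_image, Finset.mem_product, Prod.exists, sub_nonneg]
  constructor
  · rintro ⟨t, ht, h⟩ p (⟨hp, h0⟩ | ⟨p₁, p₂, q₁, q₂, ⟨⟨hp, h0⟩, hq, h1⟩, rfl⟩)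
    · have : (0 : ℝ) ≤ e p := by exact_mod_cast h0
      exact (mul_nonneg ht this).trans (h p hp)
    · rw [rationalForm_smul_sub_smul]
      have h0 : (0 : ℝ) < e (p₁, p₂) := by exact_mod_cast h0
      have h1 : (e (q₁, q₂) : ℝ) < 0 := by exact_mod_cast h1
      nlinarith [h _ hp, h _ hq]
  · intro h
    let T := insert 0 ((L.filter (fun p => e p < 0)).image (fun p => rationalForm p z / e p))
    have hT : T.Nonempty := ⟨0, Finset.mem_insert_self _ _⟩
    have hle : ∀ t ∈ T, t ≤ T.max' hT := fun t ht => Finset.le_max' T t ht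
    have hmem : T.max' hT ∈ T := Finset.max'_mem T hT
    generalize T.max' hT = t at hle hmem
    refine ⟨t, hle 0 (Finset.mem_insert_self _ _), fun p hp => ?_⟩
    rcases lt_trichotomy (e p) 0 with h0 | h0 | h0
    · have hr : (e p : ℝ) < 0 := by exact_mod_cast h0
      refine (div_le_iff_of_neg hr).1 (hle _ (Finset.mem_insert_of_mem
        (Finset.mem_image_of_mem _ (Finset.mem_filter.2 ⟨hp, h0⟩))))
    · simpa [h0] using h p (Or.inl ⟨hp, h0.ge⟩)
    · have hr : (0 : ℝ) < e p := by exact_mod_cast h0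
      rcases Finset.mem_insert.1 hmem with rfl | hm
      · simpa using h p (Or.inl ⟨hp, h0.le⟩)
      · obtain ⟨q, hq, rfl⟩ := Finset.mem_image.1 hm
        obtain ⟨hq, h1⟩ := Finset.mem_filter.1 hq
        have hr1 : (e q : ℝ) < 0 := by exact_mod_cast h1
        have := h _ (Or.inr ⟨p.1, p.2, q.1, q.2, ⟨⟨hp, h0⟩, hq, h1⟩, rfl⟩)
        rw [rationalForm_smul_sub_smul] at this
        rw [div_mul_eq_mul_div, div_le_iff_of_neg hr1]
        linarith

/-- The points `x` lying above a combination of the exponents in `G` with nonnegative weights of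
total mass `s`, as a cone in `(x, s)`. -/
def exponentCone (G : Finset (Fin d →₀ ℕ)) : Set ((Fin d → ℝ) × ℝ) :=
  {z | ∃ w : (Fin d →₀ ℕ) → ℝ, (∀ g ∈ G, 0 ≤ w g) ∧
    (∀ i, ∑ g ∈ G, w g * g i ≤ z.1 i) ∧ ∑ g ∈ G, w g = z.2}

lemma isRationalCone_exponentCone (G : Finset (Fin d →₀ ℕ)) :
    IsRationalCone (exponentCone G) := by
  classical
  induction G using Finset.induction_on with
  | empty =>
    refine ⟨Finset.univ.image (fun i => (Pi.single i 1, 0)) ∪ {(0, 1), (0, -1)}, ?_⟩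
    ext z
    simp only [exponentCone, Finset.notMem_empty, false_imp_iff, implies_true, true_and,
      Finset.sum_empty, Set.mem_ofPred_eq, exists_const, Finset.mem_union, Finset.mem_image,
      Finset.mem_univ, Finset.mem_insert, Finset.mem_singleton]
    have hsingle : ∀ i, rationalForm (Pi.single i 1, 0) z = z.1 i := by
      intro i
      simp [rationalForm, Pi.single_apply, apply_ite (Rat.cast : ℚ → ℝ)]
    constructor
    · rintro ⟨h0, h1⟩ p (⟨i, rfl⟩ | rfl | rfl)
      · rw [hsingle]
        exact h0 i
      · simp [rationalForm, ← h1]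
      · simp [rationalForm, ← h1]
    · intro h
      refine ⟨fun i => hsingle i ▸ h _ (Or.inl ⟨i, rfl⟩), le_antisymm ?_ ?_⟩
      · simpa [rationalForm] using h _ (Or.inr (Or.inl rfl))
      · simpa [rationalForm] using h _ (Or.inr (Or.inr rfl))
  | insert a G ha ih =>
    have hv : ∀ p : (Fin d → ℚ) × ℚ,
        ∃ q : ℚ, rationalForm p ((fun i => (a i : ℝ)), 1) = q := fun p =>
      ⟨∑ i, p.1 i * a i + p.2, by simp [rationalForm]⟩
    convert ih.add_ray hv using 1
    ext z
    simp only [exponentCone, Set.mem_ofPred_eq, Prod.fst_sub, Prod.snd_sub, Prod.smul_fst,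
      Prod.smul_snd, Pi.sub_apply, Pi.smul_apply, smul_eq_mul, mul_one,
      Finset.sum_insert ha, Finset.forall_mem_insert]
    constructor
    · rintro ⟨w, ⟨h0, h1⟩, h2, h3⟩
      exact ⟨w a, h0, w, h1, fun i => by linarith [h2 i], by linarith⟩
    · rintro ⟨t, ht, w, h1, h2, h3⟩
      have hne : ∀ g ∈ G, Function.update w a t g = w g := fun g hg =>
        Function.update_of_ne (ne_of_mem_of_not_mem hg ha) _ _
      refine ⟨Function.update w a t, ⟨by simpa using ht, fun g hg => hne g hg ▸ h1 g hg⟩,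
        fun i => ?_, ?_⟩
      · rw [Finset.sum_congr rfl fun g hg => by rw [hne g hg], Function.update_self]
        linarith [h2 i]
      · rw [Finset.sum_congr rfl fun g hg => hne g hg, Function.update_self]
        linarith

lemma convex_rationalAffine_nonneg (c : Fin d → ℚ) (b : ℚ) :
    Convex ℝ {x : Fin d → ℝ | 0 ≤ rationalAffine c b x} := by
  intro x hx y hy s t hs ht hst
  have : rationalAffine c b (s • x + t • y) =
      s * rationalAffine c b x + t * rationalAffine c b y := by
    have hb : (b : ℝ) = s * b + t * b := by rw [← add_mul, hst, one_mul]
    simp only [rationalAffine, Pi.add_apply, Pi.smul_apply, smul_eq_mul, mul_add,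
      Finset.sum_add_distrib, Finset.mul_sum, mul_left_comm s, mul_left_comm t]
    linarith
  rw [Set.mem_ofPred_eq, this]
  exact add_nonneg (mul_nonneg hs hx) (mul_nonneg ht hy)

lemma exists_halfspaces_exponentCone (G : Finset (Fin d →₀ ℕ)) :
    ∃ L : Finset ((Fin d → ℚ) × ℚ), {x | (x, 1) ∈ exponentCone G} =
      ⋂ p ∈ L, {x | 0 ≤ rationalAffine p.1 p.2 x} := by
  obtain ⟨L, hL⟩ := isRationalCone_exponentCone G
  refine ⟨L, ?_⟩
  ext x
  simp only [hL, Set.mem_ofPred_eq, rationalForm_one, Set.mem_iInter]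

end RationalCone

section Newton

variable {d : ℕ}

lemma exists_finset_generators (E : Set (Fin d →₀ ℕ)) :
    ∃ G : Finset (Fin d →₀ ℕ), ↑G ⊆ E ∧ ∀ a ∈ E, ∃ g ∈ G, g ≤ a := by
  have hfin : {a | Minimal (· ∈ E) a}.Finite :=
    WellQuasiOrderedLE.finite_of_isAntichain (setOfPred_minimal_antichain _)
  refine ⟨hfin.toFinset, fun a ha => ?_, fun a ha => ?_⟩
  · exact ((Set.Finite.mem_toFinset hfin).1 ha).1
  · obtain ⟨b, hb, hmin⟩ := (Set.isPWO_of_wellQuasiOrderedLE E).exists_le_minimal ha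
    exact ⟨b, (Set.Finite.mem_toFinset hfin).2 hmin, hb⟩

/-- The convex hull of an upper set of exponents is stable under adding nonnegative vectors to its
exponents. -/
lemma add_mem_convexHull_exponents {E : Set (Fin d →₀ ℕ)} (hE : IsUpperSet E) {g : Fin d →₀ ℕ}
    (hg : g ∈ E) {v : Fin d → ℝ} (hv : 0 ≤ v) :
    (fun i => (g i : ℝ)) + v ∈
      convexHull ℝ ((fun (a : Fin d →₀ ℕ) (i : Fin d) => (a i : ℝ)) '' E) := by
  classical
  obtain ⟨N, hN⟩ : ∃ N : ℕ, ∀ i, v i ≤ N := by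
    refine ⟨⌈∑ i, v i⌉₊, fun i => le_trans ?_ (Nat.le_ceil _)⟩
    exact Finset.single_le_sum (fun i _ => hv i) (Finset.mem_univ i)
  have hmem : v ∈ convexHull ℝ (Set.univ.pi fun _ : Fin d => ({0, (N : ℝ)} : Set ℝ)) := by
    rw [convexHull_pi]
    intro i _
    rw [convexHull_pair, segment_eq_Icc (Nat.cast_nonneg N)]
    exact ⟨hv i, hN i⟩
  refine convexHull_min ?_ ((convex_convexHull ℝ _).translate_preimage_right
    (fun i => (g i : ℝ))) hmem
  intro u hu
  refine subset_convexHull ℝ _ ⟨g + Finsupp.equivFunOnFinite.symm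
    (fun i => if u i = 0 then 0 else N), hE le_self_add hg, ?_⟩
  ext i
  rcases hu i (Set.mem_univ i) with h | h
  · simp [h]
  · rw [Set.mem_singleton_iff] at h
    by_cases hN0 : N = 0 <;> simp [h, hN0]

lemma convexHull_exponents_eq {E : Set (Fin d →₀ ℕ)} (hE : IsUpperSet E)
    {G : Finset (Fin d →₀ ℕ)} (hGE : ↑G ⊆ E) (hG : ∀ a ∈ E, ∃ g ∈ G, g ≤ a) :
    convexHull ℝ ((fun (a : Fin d →₀ ℕ) (i : Fin d) => (a i : ℝ)) '' E) =
      {x | (x, 1) ∈ exponentCone G} := by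
  classical
  apply subset_antisymm
  · refine convexHull_min ?_ ?_
    · rintro _ ⟨a, ha, rfl⟩
      obtain ⟨g, hg, hga⟩ := hG a ha
      refine ⟨Pi.single g 1, fun h _ => ?_, fun i => ?_, ?_⟩
      · rw [Pi.single_apply]
        split_ifs <;> norm_num
      · simpa [Pi.single_apply, hg] using hga i
      · simp [Pi.single_apply, hg]
    · obtain ⟨L, hL⟩ := exists_halfspaces_exponentCone G
      rw [hL]
      exact convex_iInter₂ fun p _ => convex_rationalAffine_nonneg p.1 p.2
  · rintro x ⟨w, hw, hx, hsum⟩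
    let v : Fin d → ℝ := x - fun i => ∑ g ∈ G, w g * g i
    have hv : 0 ≤ v := fun i => sub_nonneg.2 (hx i)
    have : x = ∑ g ∈ G, w g • ((fun i => (g i : ℝ)) + v) := by
      have hsum : ∑ g ∈ G, w g = 1 := hsum
      ext i
      simp only [smul_add, Finset.sum_add_distrib, Pi.add_apply, Finset.sum_apply, Pi.smul_apply,
        smul_eq_mul, v, Pi.sub_apply]
      rw [← Finset.sum_mul, hsum]
      ring
    rw [this]
    exact (convex_convexHull ℝ _).sum_mem hw hsum
      fun g hg => add_mem_convexHull_exponents hE (hGE hg) hv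

lemma exists_newtonPolyhedron_eq (k : Type) [Field k] (I : Ideal (MvPolynomial (Fin d) k)) :
    ∃ G : Finset (Fin d →₀ ℕ), newtonPolyhedron k d I = {x | (x, 1) ∈ exponentCone G} := by
  have hE : IsUpperSet {a : Fin d →₀ ℕ | (monomial a (1 : k) : MvPolynomial (Fin d) k) ∈ I} := by
    intro a b hab ha
    obtain ⟨c, rfl⟩ := exists_add_of_le hab
    have : (monomial (a + c) (1 : k) : MvPolynomial (Fin d) k) =
        monomial a 1 * monomial c 1 := by
      rw [monomial_mul, one_mul]
    rw [Set.mem_ofPred_eq, this]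
    exact I.mul_mem_right _ ha
  obtain ⟨G, hGE, hG⟩ := exists_finset_generators _
  exact ⟨G, convexHull_exponents_eq hE hGE hG⟩

end Newton

section Jordan

variable {d : ℕ}

/-- A set whose indicator is piecewise polynomial with rational data and whose frontier is null. -/
structure RationalJordan (A : Set (Fin d → ℝ)) : Prop where
  indicator_mem : Set.indicator A 1 ∈ rationalPiecewise d
  volume_frontier : MeasureTheory.volume (frontier A) = 0

namespace RationalJordan

lemma compl {A : Set (Fin d → ℝ)} (hA : RationalJordan A) : RationalJordan Aᶜ where
  indicator_mem := by
    rw [Set.indicator_compl]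
    exact sub_mem (one_mem _) hA.indicator_mem
  volume_frontier := by
    rw [frontier_compl]
    exact hA.volume_frontier

lemma inter {A B : Set (Fin d → ℝ)} (hA : RationalJordan A) (hB : RationalJordan B) :
    RationalJordan (A ∩ B) where
  indicator_mem := by
    rw [Set.inter_indicator_one]
    exact mul_mem hA.indicator_mem hB.indicator_mem
  volume_frontier := by
    refine MeasureTheory.measure_mono_null (frontier_inter_subset A B)
      (MeasureTheory.measure_union_null ?_ ?_)
    · exact MeasureTheory.measure_mono_null Set.inter_subset_left hA.volume_frontier
    · exact MeasureTheory.measure_mono_null Set.inter_subset_right hB.volume_frontier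

lemma univ : RationalJordan (Set.univ : Set (Fin d → ℝ)) where
  indicator_mem := by
    rw [Set.indicator_univ]
    exact one_mem _
  volume_frontier := by simp

lemma biInter {ι : Type*} (s : Finset ι) {A : ι → Set (Fin d → ℝ)}
    (hA : ∀ i, RationalJordan (A i)) : RationalJordan (⋂ i ∈ s, A i) := by
  classical
  induction s using Finset.induction_on with
  | empty => simpa using univ
  | insert i s _ ih =>
    rw [Finset.set_biInter_insert]
    exact (hA i).inter ih

lemma iInter {ι : Type*} [Fintype ι] {A : ι → Set (Fin d → ℝ)}
    (hA : ∀ i, RationalJordan (A i)) : RationalJordan (⋂ i, A i) := by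
  simpa using biInter Finset.univ hA

lemma exponentCone_slice (G : Finset (Fin d →₀ ℕ)) :
    RationalJordan {x | (x, 1) ∈ exponentCone G} := by
  obtain ⟨L, hL⟩ := exists_halfspaces_exponentCone G
  rw [hL]
  exact biInter L fun p => ⟨rationalPiecewise.indicator_mem p.1 p.2,
    (convex_rationalAffine_nonneg p.1 p.2).addHaar_frontier _⟩

lemma measurableSet {A : Set (Fin d → ℝ)} (hA : RationalJordan A) : MeasurableSet A :=
  (measurable_indicator_const_iff (1 : ℝ)).1
    (rationalPiecewise.measurable_of_mem hA.indicator_mem)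

open scoped Pointwise in
/-- Lattice points of dilates are counted asymptotically by a rational volume. -/
theorem exists_rat_tendsto_card {A : Set (Fin d → ℝ)} (hA : RationalJordan A) (M : ℕ) :
    ∃ q : ℚ, Tendsto (fun n : ℕ => (Nat.card ↑((A ∩ Set.univ.pi fun _ => Set.Icc (0 : ℝ) M) ∩
      (n : ℝ)⁻¹ • (Submodule.span ℤ (Set.range (Pi.basisFun ℝ (Fin d))) : Set (Fin d → ℝ))) : ℝ) /
        (n : ℝ) ^ d) atTop (nhds (q : ℝ)) := by
  obtain ⟨q, hq⟩ := rationalPiecewise.exists_rat_integral hA.indicator_mem M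
  refine ⟨q, ?_⟩
  have hbox : MeasurableSet (Set.univ.pi fun _ : Fin d => Set.Icc (0 : ℝ) M) :=
    MeasurableSet.univ_pi fun _ => measurableSet_Icc
  have hvol : MeasureTheory.volume.real (A ∩ Set.univ.pi fun _ => Set.Icc (0 : ℝ) M) = q := by
    rw [← hq, ← MeasureTheory.Measure.restrict_pi_pi,
      MeasureTheory.integral_indicator_one hA.measurableSet,
      MeasureTheory.measureReal_restrict_apply hA.measurableSet]
    rfl
  rw [← hvol]
  have := tendsto_card_div_pow_atTop_volume
    (A ∩ Set.univ.pi fun _ : Fin d => Set.Icc (0 : ℝ) M)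
    ((Bornology.IsBounded.pi fun _ => Metric.isBounded_Icc _ _).subset Set.inter_subset_right)
    (hA.measurableSet.inter hbox) ?_
  · simpa only [Fintype.card_fin] using this
  · refine MeasureTheory.measure_mono_null (frontier_inter_subset A _)
      (MeasureTheory.measure_union_null ?_ ?_)
    · exact MeasureTheory.measure_mono_null Set.inter_subset_left hA.volume_frontier
    · exact MeasureTheory.measure_mono_null Set.inter_subset_right
        ((convex_pi fun _ _ => convex_Icc _ _).addHaar_frontier _)

end RationalJordan

end Jordan

section Counting

variable {d : ℕ}

lemma exponentCone_mono {G : Finset (Fin d →₀ ℕ)} {x y : Fin d → ℝ} {s : ℝ} (hxy : x ≤ y)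
    (hx : (x, s) ∈ exponentCone G) : (y, s) ∈ exponentCone G := by
  obtain ⟨w, h0, h1, h2⟩ := hx
  exact ⟨w, h0, fun i => (h1 i).trans (hxy i), h2⟩

/-- Coordinates beyond the largest exponent of the generators can be increased freely without
entering the polyhedron. -/
lemma exponentCone_of_le_of_large {G : Finset (Fin d →₀ ℕ)} {M : ℕ} (hM : ∀ g ∈ G, ∀ i, g i ≤ M)
    {x y : Fin d → ℝ} (hxy : ∀ i, y i ≤ x i ∨ (M : ℝ) ≤ x i) (hy : (y, 1) ∈ exponentCone G) :
    (x, 1) ∈ exponentCone G := by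
  obtain ⟨w, h0, h1, h2⟩ := hy
  refine ⟨w, h0, fun i => ?_, h2⟩
  rcases hxy i with h | h
  · exact (h1 i).trans h
  · calc ∑ g ∈ G, w g * g i ≤ ∑ g ∈ G, w g * M :=
          Finset.sum_le_sum fun g hg =>
            mul_le_mul_of_nonneg_left (by exact_mod_cast hM g hg i) (h0 g hg)
      _ = M := by rw [← Finset.sum_mul, show ∑ g ∈ G, w g = 1 from h2, one_mul]
      _ ≤ x i := h

lemma mem_smul_image_iff {n : ℕ} (hn : n ≠ 0) {C : Set (Fin d → ℝ)} {x : Fin d → ℝ} :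
    x ∈ (fun y : Fin d → ℝ => (n : ℝ) • y) '' C ↔ (n : ℝ)⁻¹ • x ∈ C :=
  Set.mem_smul_set_iff_inv_smul_mem₀ (Nat.cast_ne_zero.2 hn) C x

/-- If only finitely many lattice points of the `n`-th dilate lie in every `A i` and outside every
`B j`, they all lie in the `n`-th dilate of a fixed box. -/
lemma le_mul_of_finite {ι κ : Type*} {A : ι → Finset (Fin d →₀ ℕ)} {B : κ → Finset (Fin d →₀ ℕ)}
    {M : ℕ} (hM : ∀ j, ∀ g ∈ B j, ∀ l, g l ≤ M) {n : ℕ} (hn : n ≠ 0) {S : Set (Fin d →₀ ℕ)}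
    (hS : S = {a | (∀ i, ((n : ℝ)⁻¹ • (fun l => (a l : ℝ)), 1) ∈ exponentCone (A i)) ∧
      ∀ j, ((n : ℝ)⁻¹ • (fun l => (a l : ℝ)), 1) ∉ exponentCone (B j)})
    (hfin : S.Finite) {a : Fin d →₀ ℕ} (ha : a ∈ S) (l : Fin d) : a l ≤ n * M := by
  by_contra! hlt
  have hn0 : (0 : ℝ) < n := by exact_mod_cast Nat.pos_of_ne_zero hn
  have hinj : Function.Injective (fun t : ℕ => a + Finsupp.single l t) := fun s t hst =>
    Finsupp.single_injective l (add_left_cancel hst)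
  refine Set.infinite_range_of_injective hinj (hfin.subset ?_)
  rintro _ ⟨t, rfl⟩
  rw [hS] at ha ⊢
  refine ⟨fun i => exponentCone_mono ?_ (ha.1 i), fun j hj => ha.2 j
    (exponentCone_of_le_of_large (hM j) (fun m => ?_) hj)⟩
  · intro m
    refine mul_le_mul_of_nonneg_left ?_ (inv_nonneg.2 hn0.le)
    simp
  · rcases eq_or_ne l m with rfl | hm
    · right
      rw [Pi.smul_apply, smul_eq_mul, le_inv_mul_iff₀ hn0]
      exact_mod_cast hlt.le
    · left
      simp [Finsupp.single_eq_of_ne hm.symm]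

open scoped Pointwise in
/-- The lattice points of the `n`-th dilate of `T` correspond to the points of `n⁻¹ℤ^d` in `T`. -/
lemma card_inter_smul_span_eq_ncard {T : Set (Fin d → ℝ)} (hT : ∀ x ∈ T, 0 ≤ x) {n : ℕ}
    (hn : n ≠ 0) {S : Set (Fin d →₀ ℕ)}
    (hS : ∀ a : Fin d →₀ ℕ, a ∈ S ↔ (n : ℝ)⁻¹ • (fun l => (a l : ℝ)) ∈ T) :
    Nat.card ↑(T ∩ (n : ℝ)⁻¹ •
      (Submodule.span ℤ (Set.range (Pi.basisFun ℝ (Fin d))) : Set (Fin d → ℝ))) = S.ncard := by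
  have hn0 : (n : ℝ) ≠ 0 := Nat.cast_ne_zero.2 hn
  have hinj : Function.Injective
      (fun a : Fin d →₀ ℕ => (n : ℝ)⁻¹ • (fun l => (a l : ℝ))) := by
    intro a b hab
    have := smul_right_injective (Fin d → ℝ) (inv_ne_zero hn0) hab
    ext l
    exact_mod_cast congrFun this l
  rw [← Set.ncard_image_of_injective S hinj, Nat.card_coe_set_eq]
  congr 1
  ext x
  rw [Set.mem_inter_iff, Set.mem_smul_set_iff_inv_smul_mem₀ (inv_ne_zero hn0), inv_inv,
    SetLike.mem_coe, Module.Basis.mem_span_iff_repr_mem]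
  simp only [Pi.basisFun_repr, Pi.smul_apply, smul_eq_mul, Set.mem_range, algebraMap_int_eq,
    eq_intCast, Set.mem_image]
  constructor
  · rintro ⟨hx, hz⟩
    choose z hz using hz
    have hx' : (n : ℝ)⁻¹ • (fun l => (((Finsupp.equivFunOnFinite.symm fun l => (z l).toNat :
        Fin d →₀ ℕ) l : ℕ) : ℝ)) = x := by
      ext l
      have h0 : (0 : ℝ) ≤ z l := hz l ▸ mul_nonneg (Nat.cast_nonneg n) (hT x hx l)
      have h1 : (((z l).toNat : ℤ) : ℝ) = z l := by
        rw [Int.toNat_of_nonneg (by exact_mod_cast h0)]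
      rw [Int.cast_natCast] at h1
      rw [Pi.smul_apply, Finsupp.coe_equivFunOnFinite_symm, h1, hz, smul_eq_mul,
        inv_mul_cancel_left₀ hn0]
    exact ⟨_, (hS _).2 (hx'.symm ▸ hx), hx'⟩
  · rintro ⟨a, ha, rfl⟩
    refine ⟨(hS a).1 ha, fun l => ⟨a l, ?_⟩⟩
    simp [mul_inv_cancel_left₀ hn0]

end Counting

/-- Let `I_1, …, I_r, J_1, …, J_s` be nonzero monomial ideals and
`S_n = {a ∈ ℕ^d : a ∈ n·conv(I_i) ∀ i, a ∉ n·conv(J_j) ∀ j}`.  If `|S_n| < ∞` for `n ≫ 0`,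
then `lim |S_n|/n^d` exists and is rational. -/
theorem newton_polyhedra_count_tendsto_rational
    (k : Type) [Field k] (d : ℕ) (hd : 1 ≤ d) (r s : ℕ)
    (I : Fin r → Ideal (MvPolynomial (Fin d) k))
    (J : Fin s → Ideal (MvPolynomial (Fin d) k))
    (hImono : ∀ i, IsMonomialIdeal (I i)) (hJmono : ∀ j, IsMonomialIdeal (J j))
    (hInz : ∀ i, I i ≠ ⊥) (hJnz : ∀ j, J j ≠ ⊥)
    (S : ℕ → Set (Fin d →₀ ℕ))
    (hS : ∀ n, S n = {a : Fin d →₀ ℕ |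
      (∀ i, (fun l => ((a l : ℝ))) ∈
        (fun x : Fin d → ℝ => (n : ℝ) • x) '' newtonPolyhedron k d (I i)) ∧
      (∀ j, (fun l => ((a l : ℝ))) ∉
        (fun x : Fin d → ℝ => (n : ℝ) • x) '' newtonPolyhedron k d (J j))})
    (N₀ : ℕ) (hfin : ∀ n, N₀ ≤ n → (S n).Finite) :
    ∃ L : ℚ, Tendsto (fun n : ℕ => ((S n).ncard : ℝ) / (n : ℝ) ^ d) atTop (nhds (L : ℝ)) := by
  choose A hA using fun i => exists_newtonPolyhedron_eq k (I i)
  choose B hB using fun j => exists_newtonPolyhedron_eq k (J j)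
  obtain ⟨M, hM⟩ : ∃ M : ℕ, ∀ j, ∀ g ∈ B j, ∀ l, g l ≤ M := by
    refine ⟨∑ j, ∑ g ∈ B j, ∑ l, g l, fun j g hg l => ?_⟩
    calc g l ≤ ∑ l, g l := Finset.single_le_sum (fun _ _ => Nat.zero_le _) (Finset.mem_univ l)
      _ ≤ ∑ g ∈ B j, ∑ l, g l :=
        Finset.single_le_sum (f := fun g : Fin d →₀ ℕ => ∑ l, g l) (fun _ _ => Nat.zero_le _) hg
      _ ≤ _ := Finset.single_le_sum (f := fun j => ∑ g ∈ B j, ∑ l, g l)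
        (fun _ _ => Nat.zero_le _) (Finset.mem_univ j)
  let T : Set (Fin d → ℝ) := (⋂ i, {x | (x, 1) ∈ exponentCone (A i)}) ∩
    ⋂ j, {x | (x, 1) ∈ exponentCone (B j)}ᶜ
  have hT : RationalJordan T :=
    (RationalJordan.iInter fun i => RationalJordan.exponentCone_slice (A i)).inter
      (RationalJordan.iInter fun j => (RationalJordan.exponentCone_slice (B j)).compl)
  obtain ⟨q, hq⟩ := hT.exists_rat_tendsto_card M
  refine ⟨q, hq.congr' ?_⟩
  filter_upwards [eventually_ge_atTop N₀, eventually_ne_atTop 0] with n hn hn0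
  have hSn : S n = {a | (∀ i, ((n : ℝ)⁻¹ • (fun l => (a l : ℝ)), 1) ∈ exponentCone (A i)) ∧
      ∀ j, ((n : ℝ)⁻¹ • (fun l => (a l : ℝ)), 1) ∉ exponentCone (B j)} := by
    rw [hS]
    simp only [mem_smul_image_iff hn0, hA, hB, Set.mem_ofPred_eq]
  rw [card_inter_smul_span_eq_ncard (fun x hx l => (hx.2 l (Set.mem_univ l)).1) hn0]
  intro a
  have hbox : a ∈ S n → (n : ℝ)⁻¹ • (fun l => (a l : ℝ)) ∈
      Set.univ.pi fun _ : Fin d => Set.Icc (0 : ℝ) M := by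
    intro ha l _
    refine ⟨by simpa using by positivity, ?_⟩
    rw [Pi.smul_apply, smul_eq_mul,
      inv_mul_le_iff₀ (by exact_mod_cast Nat.pos_of_ne_zero hn0)]
    exact_mod_cast le_mul_of_finite hM hn0 hSn (hfin n hn) ha l
  have hmem : a ∈ S n ↔ (n : ℝ)⁻¹ • (fun l => (a l : ℝ)) ∈ T := by
    simp [hSn, T]
  exact ⟨fun ha => ⟨hmem.1 ha, hbox ha⟩, fun ha => hmem.2 ha.1⟩
end
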